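/- Let H ∈ (1/4,1/2), T > 0, N > 0, and let σ, u₀, v₀, I₀ satisfy the same hypotheses as in the well-posedness of the skeleton equation (σ ∈ C^{0,1,1} with σ(t,x,0)=0, bounded ∂_u σ and ∂²_{xu} σ, Lipschitz ∂_u σ in u; u₀, v₀ α-Hölder; ‖I₀‖_{Z^p(T)} < ∞ for some p > 2/(4H−1)). For measurable g : [0,T]×ℝ → ℝ with ∫_0^T ‖g(s,·)‖²_𝓗 ds ≤ N, let u^g denote the unique continuous solution of u^g(t,x) = I₀(t,x) + ∫_0^t ⟨ G(t−s, x−·)·σ(s, ·, u^g(s,·)), g(s,·) ⟩_𝓗 ds. Suppose g_n (n ≥ 1) and g all satisfy ∫_0^T ‖·‖²_𝓗 ds ≤ N, and that g_n → g weakly in the sense that for every measurable h : [0,T]×ℝ → ℝ with ∫_0^T ‖h(s,·)‖²_𝓗 ds < ∞ one has ∫_0^T ⟨g_n(s,·), h(s,·)⟩_𝓗 ds → ∫_0^T ⟨g(s,·), h(s,·)⟩_𝓗 ds. Then u^{g_n} → u^g uniformly on every compact subset of [0,T]×ℝ. -/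

import Mathlib

open MeasureTheory

/-- The one-dimensional wave kernel `G(t,x) = (1/2)·1_{|x|<t}`. -/
noncomputable def G (t x : ℝ) : ℝ := if |x| < t then 1 / 2 else 0

/-- The constant `c_{2,H}`. -/
noncomputable def c2H (H : ℝ) : ℝ :=
  H ^ ((1 : ℝ) / 2) * ((1 : ℝ) / 2 - H) ^ ((1 : ℝ) / 2) * (Real.Gamma (H + 1 / 2))⁻¹ *
    ((∫ t in Set.Ioi (0 : ℝ), ((1 + t) ^ (H - 1 / 2) - t ^ (H - 1 / 2)) ^ 2) + 1 / (2 * H))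
      ^ ((1 : ℝ) / 2)

/-- The `𝓗` inner product
`⟨φ,ψ⟩_𝓗 = c_{2,H} ∫∫ [φ(z+h)−φ(z)][ψ(z+h)−ψ(z)] |h|^{2H−2} dz dh`. -/
noncomputable def Hinner (H : ℝ) (φ ψ : ℝ → ℝ) : ℝ :=
  c2H H * ∫ q : ℝ × ℝ, (φ (q.1 + q.2) - φ q.1) * (ψ (q.1 + q.2) - ψ q.1) * |q.2| ^ (2 * H - 2)

/-- The squared `𝓗`-norm, valued in `ℝ≥0∞`. -/
noncomputable def HnormSq (H : ℝ) (φ : ℝ → ℝ) : ENNReal :=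
  ENNReal.ofReal (c2H H) *
    ∫⁻ h : ℝ, ∫⁻ z : ℝ, ENNReal.ofReal ((φ (z + h) - φ z) ^ 2 * |h| ^ (2 * H - 2))

/-- The `Z^q(T)`-norm (valued in `ℝ≥0∞`). -/
noncomputable def Znorm (H p T : ℝ) (v : ℝ → ℝ → ℝ) : ENNReal :=
  (⨆ t ∈ Set.Icc (0 : ℝ) T, eLpNorm (v t) (ENNReal.ofReal p) volume) +
    ⨆ t ∈ Set.Icc (0 : ℝ) T,
      (∫⁻ h : ℝ, (eLpNorm (fun x => v t (x + h) - v t x) (ENNReal.ofReal p) volume) ^ 2 *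
          ENNReal.ofReal (|h| ^ (2 * H - 2))) ^ ((1 : ℝ) / 2)

/-- `I₀(t,x) := (1/2)[u₀(x+t) + u₀(x−t)] + (1/2)∫_{x−t}^{x+t} v₀(y) dy`. -/
noncomputable def I0 (u₀ v₀ : ℝ → ℝ) (t x : ℝ) : ℝ :=
  (u₀ (x + t) + u₀ (x - t)) / 2 + (1 / 2) * ∫ y in (x - t)..(x + t), v₀ y

/-- `v` is a continuous solution of the skeleton equation
`v(t,x) = I₀(t,x) + ∫₀ᵗ ⟨G(t−s,x−·)σ(s,·,v(s,·)), g(s,·)⟩_𝓗 ds` on `[0,T] × ℝ`,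
with all the integrals involved absolutely convergent. -/
def IsSkelSolution (H T : ℝ) (σ : ℝ → ℝ → ℝ → ℝ) (u₀ v₀ : ℝ → ℝ)
    (g v : ℝ → ℝ → ℝ) : Prop :=
  ContinuousOn (fun q : ℝ × ℝ => v q.1 q.2) (Set.Icc (0 : ℝ) T ×ˢ (Set.univ : Set ℝ)) ∧
  ∀ t ∈ Set.Icc (0 : ℝ) T, ∀ x : ℝ,
    (∀ s ∈ Set.Icc (0 : ℝ) t, Integrable (fun q : ℝ × ℝ =>
      (G (t - s) (x - (q.1 + q.2)) * σ s (q.1 + q.2) (v s (q.1 + q.2)) -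
          G (t - s) (x - q.1) * σ s q.1 (v s q.1)) *
        (g s (q.1 + q.2) - g s q.1) * |q.2| ^ (2 * H - 2))) ∧
    IntegrableOn (fun s => Hinner H (fun z => G (t - s) (x - z) * σ s z (v s z)) (g s))
      (Set.Icc (0 : ℝ) t) ∧
    v t x = I0 u₀ v₀ t x +
      ∫ s in Set.Icc (0 : ℝ) t, Hinner H (fun z => G (t - s) (x - z) * σ s z (v s z)) (g s)

/-- The singular weight `|l|^{2H-2}`. -/
noncomputable def wgt (H l : ℝ) : ENNReal := ENNReal.ofReal (|l| ^ (2 * H - 2))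

/-- The integral of `min(|l|,1)^{1/2}` against the singular weight. -/
noncomputable def wgtConst (H : ℝ) : ENNReal :=
  ∫⁻ l : ℝ, ENNReal.ofReal (√(min |l| 1)) * wgt H l

/-- The squared `𝓗`-norm without its multiplicative constant. -/
noncomputable def hnSq (H : ℝ) (φ : ℝ → ℝ) : ENNReal :=
  ∫⁻ h : ℝ, ∫⁻ z : ℝ, ENNReal.ofReal ((φ (z + h) - φ z) ^ 2) * wgt H h

lemma measurable_wgt (H : ℝ) : Measurable (wgt H) := by
  unfold wgt; fun_prop

lemma HnormSq_eq (H : ℝ) (φ : ℝ → ℝ) :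
    HnormSq H φ = ENNReal.ofReal (c2H H) * hnSq H φ := by
  unfold HnormSq hnSq wgt
  simp_rw [ENNReal.ofReal_mul (sq_nonneg _)]

lemma c2H_pos {H : ℝ} (hH : H ∈ Set.Ioo (1 / 4 : ℝ) (1 / 2 : ℝ)) : 0 < c2H H := by
  obtain ⟨h1, h2⟩ := hH
  have hG : 0 < Real.Gamma (H + 1 / 2) := Real.Gamma_pos_of_pos (by linarith)
  have hI : 0 ≤ ∫ t in Set.Ioi (0 : ℝ), ((1 + t) ^ (H - 1 / 2) - t ^ (H - 1 / 2)) ^ 2 :=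
    integral_nonneg fun t => sq_nonneg _
  have h3 : 0 < 1 / (2 * H) := by positivity
  unfold c2H
  have h4 : 0 < (1 : ℝ) / 2 - H := by linarith
  have h5 : 0 < H := by linarith
  positivity

lemma wgtConst_lt_top {H : ℝ} (hH : H ∈ Set.Ioo (1 / 4 : ℝ) (1 / 2 : ℝ)) :
    wgtConst H < ⊤ := by
  obtain ⟨h1, h2⟩ := hH
  have key : IntegrableOn (fun l : ℝ => √(min l 1) * l ^ (2 * H - 2)) (Set.Ioi 0) := by
    rw [← Set.Ioc_union_Ioi_eq_Ioi (zero_le_one (α := ℝ))]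
    refine IntegrableOn.union ?_ ?_
    · have h := (intervalIntegral.intervalIntegrable_rpow' (a := 0) (b := 1)
        (r := 2 * H - 3 / 2) (by linarith)).1
      refine h.congr_fun (fun l hl => ?_) measurableSet_Ioc
      have : min l 1 = l := min_eq_left hl.2
      simp only [this]
      rw [Real.sqrt_eq_rpow, ← Real.rpow_add hl.1]
      congr 1; ring
    · have h := integrableOn_Ioi_rpow_of_lt (a := 2 * H - 2) (by linarith) one_pos
      refine h.congr_fun (fun l hl => ?_) measurableSet_Ioi
      have : min l 1 = 1 := min_eq_right (le_of_lt hl)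
      simp [this]
  have key2 : Integrable (fun l : ℝ => √(min |l| 1) * |l| ^ (2 * H - 2)) := by
    have hpos : IntegrableOn (fun l : ℝ => √(min |l| 1) * |l| ^ (2 * H - 2)) (Set.Ioi 0) :=
      key.congr_fun (fun l hl => by simp only [abs_of_pos (Set.mem_Ioi.1 hl)]) measurableSet_Ioi
    rw [← integrableOn_univ, ← Set.Iic_union_Ioi (a := (0 : ℝ))]
    refine IntegrableOn.union ?_ hpos
    have hmp : MeasurePreserving (Neg.neg : ℝ → ℝ) := Measure.measurePreserving_neg volume
    have := (hmp.integrableOn_comp_preimage (Homeomorph.neg ℝ).measurableEmbedding).2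
      (Iff.mpr integrableOn_Ici_iff_integrableOn_Ioi hpos)
    simpa [Function.comp_def] using this
  have := key2.lintegral_lt_top
  unfold wgtConst wgt
  simpa only [ENNReal.ofReal_mul (Real.sqrt_nonneg _)] using this

/-- Half the indicator function of the open interval `(a, b)`. -/
noncomputable def halfInd (a b y : ℝ) : ℝ := if a < y ∧ y < b then 1 / 2 else 0

lemma measurable_halfInd_comp {α : Type*} [MeasurableSpace α] {a b y : α → ℝ}
    (ha : Measurable a) (hb : Measurable b) (hy : Measurable y) :
    Measurable fun p => halfInd (a p) (b p) (y p) :=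
  Measurable.ite ((measurableSet_lt ha hy).inter (measurableSet_lt hy hb))
    measurable_const measurable_const

lemma lintegral_halfInd_sub_sq_le (a b a' b' : ℝ) :
    ∫⁻ y, ENNReal.ofReal ((halfInd a b y - halfInd a' b' y) ^ 2) ≤
      ENNReal.ofReal (|a - a'| + |b - b'|) := by
  have h1 : ∀ y, ENNReal.ofReal ((halfInd a b y - halfInd a' b' y) ^ 2) ≤
      (Set.uIcc a a').indicator 1 y + (Set.uIcc b b').indicator 1 y := by
    intro y
    by_cases ha : y ∈ Set.uIcc a a'
    · simp only [Set.indicator_of_mem ha, Pi.one_apply]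
      refine le_trans ?_ le_self_add
      rw [← ENNReal.ofReal_one]
      apply ENNReal.ofReal_le_ofReal
      unfold halfInd; split_ifs <;> norm_num
    by_cases hb : y ∈ Set.uIcc b b'
    · simp only [Set.indicator_of_mem hb, Pi.one_apply]
      refine le_trans ?_ le_add_self
      rw [← ENNReal.ofReal_one]
      apply ENNReal.ofReal_le_ofReal
      unfold halfInd; split_ifs <;> norm_num
    have e1 : a < y ↔ a' < y := by
      rw [Set.mem_uIcc] at ha
      constructor <;> intro h <;> by_contra h' <;> push Not at h' <;> exact ha (by grind)
    have e2 : y < b ↔ y < b' := by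
      rw [Set.mem_uIcc] at hb
      constructor <;> intro h <;> by_contra h' <;> push Not at h' <;> exact hb (by grind)
    simp [halfInd, e1, e2]
  refine (lintegral_mono h1).trans ?_
  rw [lintegral_add_left (measurable_one.indicator measurableSet_uIcc),
    lintegral_indicator_one measurableSet_uIcc, lintegral_indicator_one measurableSet_uIcc,
    ENNReal.ofReal_add (abs_nonneg _) (abs_nonneg _), abs_sub_comm a a', abs_sub_comm b b']
  simp [Set.uIcc, Real.volume_Icc, max_sub_min_eq_abs, abs_sub_comm]

lemma halfInd_add (a b y h : ℝ) : halfInd a b (y + h) = halfInd (a - h) (b - h) y := by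
  simp only [halfInd, sub_lt_iff_lt_add, lt_sub_iff_add_lt]

lemma ofReal_sq_add_le (x y : ℝ) : ENNReal.ofReal ((x + y) ^ 2) ≤
    2 * ENNReal.ofReal (x ^ 2) + 2 * ENNReal.ofReal (y ^ 2) := by
  have e : (2 : ENNReal) = ENNReal.ofReal 2 := by simp
  rw [e, ← ENNReal.ofReal_mul (by norm_num), ← ENNReal.ofReal_mul (by norm_num),
    ← ENNReal.ofReal_add (by positivity) (by positivity)]
  apply ENNReal.ofReal_le_ofReal
  nlinarith [sq_nonneg (x - y)]

lemma ofReal_sq_sub_le (x y : ℝ) : ENNReal.ofReal ((x - y) ^ 2) ≤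
    2 * ENNReal.ofReal (x ^ 2) + 2 * ENNReal.ofReal (y ^ 2) := by
  simpa [sub_eq_add_neg] using ofReal_sq_add_le x (-y)

lemma lintegral_ofReal_sq_sub_le {f g : ℝ → ℝ} (hf : Measurable f) :
    ∫⁻ y, ENNReal.ofReal ((f y - g y) ^ 2) ≤
      2 * (∫⁻ y, ENNReal.ofReal (f y ^ 2)) + 2 * ∫⁻ y, ENNReal.ofReal (g y ^ 2) := by
  refine (lintegral_mono fun y => ofReal_sq_sub_le _ _).trans ?_
  rw [lintegral_add_left (by fun_prop), lintegral_const_mul' _ _ (by simp),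
    lintegral_const_mul' _ _ (by simp)]

lemma min_le_sqrt_mul {x d : ℝ} (hx : 0 ≤ x) (hd : 0 ≤ d) :
    min x d ≤ (√d + d) * √(min x 1) := by
  have hsd := Real.sqrt_nonneg d
  rcases le_total x 1 with h | h
  · rw [min_eq_left h]
    have h1 : min x d ≤ √d * √x := by
      rcases le_total x d with h2 | h2
      · rw [min_eq_left h2]
        nlinarith [Real.mul_self_sqrt hx, Real.sqrt_le_sqrt h2, Real.sqrt_nonneg x]
      · rw [min_eq_right h2]
        nlinarith [Real.mul_self_sqrt hd, Real.sqrt_le_sqrt h2, Real.sqrt_nonneg x]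
    nlinarith [mul_nonneg hd (Real.sqrt_nonneg x)]
  · rw [min_eq_right h]
    simp only [Real.sqrt_one, mul_one]
    linarith [min_le_right x d]

lemma hnSq_halfInd_sub_le (H a b a' b' : ℝ) :
    hnSq H (fun y => halfInd a b y - halfInd a' b' y) ≤
      8 * wgtConst H *
        ENNReal.ofReal (√(|a - a'| + |b - b'|) + (|a - a'| + |b - b'|)) := by
  set d := |a - a'| + |b - b'| with hd
  have hd0 : 0 ≤ d := by positivity
  have hm : ∀ a b : ℝ, Measurable (halfInd a b) := fun a b =>
    measurable_halfInd_comp measurable_const measurable_const measurable_id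
  have key : ∀ h : ℝ, ∫⁻ z, ENNReal.ofReal
      (((halfInd a b (z + h) - halfInd a' b' (z + h)) -
        (halfInd a b z - halfInd a' b' z)) ^ 2) ≤
      8 * ENNReal.ofReal (√d + d) * ENNReal.ofReal (√(min |h| 1)) := by
    intro h
    have e8 : (8 : ENNReal) = ENNReal.ofReal 8 := by simp
    have e2 : (2 : ENNReal) = ENNReal.ofReal 2 := by simp
    have hA : ∫⁻ z, ENNReal.ofReal (((halfInd a b (z + h) - halfInd a' b' (z + h)) -
        (halfInd a b z - halfInd a' b' z)) ^ 2) ≤ ENNReal.ofReal (8 * |h|) := by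
      have : ∀ z, (halfInd a b (z + h) - halfInd a' b' (z + h)) -
        (halfInd a b z - halfInd a' b' z) =
        (halfInd (a - h) (b - h) z - halfInd a b z) -
        (halfInd (a' - h) (b' - h) z - halfInd a' b' z) := by
        intro z; rw [halfInd_add, halfInd_add]; ring
      simp_rw [this]
      refine (lintegral_ofReal_sq_sub_le (f := fun z => halfInd (a - h) (b - h) z -
        halfInd a b z) ((hm _ _).sub (hm _ _))).trans ?_
      refine (add_le_add (mul_le_mul_right (lintegral_halfInd_sub_sq_le _ _ _ _) _)
        (mul_le_mul_right (lintegral_halfInd_sub_sq_le _ _ _ _) _)).trans ?_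
      rw [e2, ← ENNReal.ofReal_mul (by norm_num), ← ENNReal.ofReal_mul (by norm_num),
        ← ENNReal.ofReal_add (by positivity) (by positivity)]
      apply ENNReal.ofReal_le_ofReal
      simp; linarith
    have hB : ∫⁻ z, ENNReal.ofReal (((halfInd a b (z + h) - halfInd a' b' (z + h)) -
        (halfInd a b z - halfInd a' b' z)) ^ 2) ≤ ENNReal.ofReal (8 * d) := by
      refine (lintegral_ofReal_sq_sub_le (f := fun z => halfInd a b (z + h) -
        halfInd a' b' (z + h)) (by
          have := hm a b; have := hm a' b'; fun_prop)).trans ?_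
      rw [lintegral_add_right_eq_self (fun z => ENNReal.ofReal
        ((halfInd a b z - halfInd a' b' z) ^ 2)) h]
      refine (add_le_add (mul_le_mul_right (lintegral_halfInd_sub_sq_le _ _ _ _) _)
        (mul_le_mul_right (lintegral_halfInd_sub_sq_le _ _ _ _) _)).trans ?_
      rw [e2, ← ENNReal.ofReal_mul (by norm_num),
        ← ENNReal.ofReal_add (by positivity) (by positivity)]
      apply ENNReal.ofReal_le_ofReal
      linarith
    calc _ ≤ ENNReal.ofReal (8 * min |h| d) := by
          rcases le_total |h| d with h' | h'
          · rwa [min_eq_left h']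
          · rwa [min_eq_right h']
      _ ≤ ENNReal.ofReal (8 * ((√d + d) * √(min |h| 1))) :=
          ENNReal.ofReal_le_ofReal
            (mul_le_mul_of_nonneg_left (min_le_sqrt_mul (abs_nonneg h) hd0) (by norm_num))
      _ = _ := by
          rw [ENNReal.ofReal_mul (by norm_num), ENNReal.ofReal_mul (by positivity), ← e8,
            mul_assoc]
  unfold hnSq
  calc _ ≤ ∫⁻ h : ℝ, 8 * ENNReal.ofReal (√d + d) *
        (ENNReal.ofReal (√(min |h| 1)) * wgt H h) := by
        refine lintegral_mono fun h => ?_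
        rw [lintegral_mul_const' _ _ (by simp [wgt]), ← mul_assoc]
        exact mul_le_mul_left (key h) _
    _ = _ := by
        rw [lintegral_const_mul' _ _ (by finiteness)]
        unfold wgtConst; ring

/-- Indicator that both `z` and `z + h` lie in `[-r, r]`. -/
noncomputable def bothIn (r z h : ℝ) : ENNReal := if |z| ≤ r ∧ |z + h| ≤ r then 1 else 0

/-- The density in `z` of the local Gagliardo-type energy on `[-r, r]`. -/
noncomputable def enDens (H r : ℝ) (φ : ℝ → ℝ) (z : ℝ) : ENNReal :=
  ∫⁻ h : ℝ, bothIn r z h * ENNReal.ofReal ((φ (z + h) - φ z) ^ 2) * wgt H h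

/-- The local Gagliardo-type energy on `[-r, r]`. -/
noncomputable def enSq (H r : ℝ) (φ : ℝ → ℝ) : ENNReal :=
  ∫⁻ h : ℝ, ∫⁻ z : ℝ, bothIn r z h * ENNReal.ofReal ((φ (z + h) - φ z) ^ 2) * wgt H h

lemma bothIn_le_one (r z h : ℝ) : bothIn r z h ≤ 1 := by
  unfold bothIn; split_ifs <;> simp

lemma measurable_bothIn_comp {α : Type*} [MeasurableSpace α] {r z h : α → ℝ}
    (hr : Measurable r) (hz : Measurable z) (hh : Measurable h) :
    Measurable fun p => bothIn (r p) (z p) (h p) :=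
  Measurable.ite ((measurableSet_le (by fun_prop) hr).inter
    (measurableSet_le (by fun_prop) hr)) measurable_const measurable_const

lemma lintegral_enDens (H r : ℝ) {φ : ℝ → ℝ} (hφ : Measurable φ) :
    ∫⁻ z, enDens H r φ z = enSq H r φ := by
  unfold enDens enSq
  apply lintegral_lintegral_swap
  apply Measurable.aemeasurable
  have h1 := measurable_wgt H
  have h2 : Measurable fun p : ℝ × ℝ => bothIn r p.1 p.2 :=
    measurable_bothIn_comp measurable_const measurable_fst measurable_snd
  have h3 : Measurable fun p : ℝ × ℝ => wgt H p.2 := h1.comp measurable_snd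
  unfold Function.uncurry
  fun_prop

lemma enSq_le_hnSq (H r : ℝ) (φ : ℝ → ℝ) : enSq H r φ ≤ hnSq H φ := by
  refine lintegral_mono fun h => lintegral_mono fun z => ?_
  exact mul_le_mul_left ((mul_le_mul_left (bothIn_le_one r z h) _).trans_eq (one_mul _)) _

lemma mul_sub_mul_sq_le {k D : ℝ → ℝ} {r : ℝ} {S : ENNReal} (hk : ∀ z, r < |z| → k z = 0)
    (hD : ∀ z, |z| ≤ r → ENNReal.ofReal (D z ^ 2) ≤ S) (z h : ℝ) :
    ENNReal.ofReal ((k (z + h) * D (z + h) - k z * D z) ^ 2) ≤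
      2 * (ENNReal.ofReal (k z ^ 2) *
        (bothIn r z h * ENNReal.ofReal ((D (z + h) - D z) ^ 2))) +
      2 * S * ENNReal.ofReal ((k (z + h) - k z) ^ 2) := by
  have aux : ∀ y, |y| ≤ r → ∀ c : ℝ, ENNReal.ofReal ((c * D y) ^ 2) ≤
      S * ENNReal.ofReal (c ^ 2) := by
    intro y hy c
    rw [mul_pow, ENNReal.ofReal_mul (sq_nonneg _), mul_comm]
    exact mul_le_mul_left (hD y hy) _
  have one_le : ∀ X : ENNReal, X ≤ 2 * X := fun X => by rw [two_mul]; exact le_self_add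
  by_cases h1 : |z| ≤ r
  · by_cases h2 : |z + h| ≤ r
    · have e : k (z + h) * D (z + h) - k z * D z =
          k z * (D (z + h) - D z) + (k (z + h) - k z) * D (z + h) := by ring
      rw [e]
      refine (ofReal_sq_add_le _ _).trans (add_le_add ?_ ?_)
      · simp only [bothIn, h1, h2, and_self, if_true, one_mul]
        rw [mul_pow, ENNReal.ofReal_mul (sq_nonneg _)]
      · rw [mul_assoc]
        exact mul_le_mul_right (aux _ h2 _) _
    · rw [hk _ (not_le.1 h2)]
      refine le_trans ?_ le_add_self
      have e : 0 * D (z + h) - k z * D z = (0 - k z) * D z := by ring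
      rw [e, mul_assoc]
      exact (aux _ h1 _).trans (one_le _)
  · rw [hk _ (not_le.1 h1)]
    by_cases h2 : |z + h| ≤ r
    · refine le_trans ?_ le_add_self
      have e : k (z + h) * D (z + h) - 0 * D z = (k (z + h) - 0) * D (z + h) := by ring
      rw [e, mul_assoc]
      exact (aux _ h2 _).trans (one_le _)
    · rw [hk _ (not_le.1 h2)]
      simp

lemma lintegral_lintegral_add {f g : ℝ × ℝ → ENNReal} (hf : Measurable f) :
    ∫⁻ h : ℝ, ∫⁻ z : ℝ, (f (z, h) + g (z, h)) =
      (∫⁻ h : ℝ, ∫⁻ z : ℝ, f (z, h)) + ∫⁻ h : ℝ, ∫⁻ z : ℝ, g (z, h) := by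
  rw [← lintegral_add_left hf.lintegral_prod_left']
  exact lintegral_congr fun h =>
    lintegral_add_left (hf.comp (measurable_id.prodMk measurable_const)) _

lemma hnSq_mul_le {H r : ℝ} {k D : ℝ → ℝ} {S : ENNReal} (hkm : Measurable k)
    (hDm : Measurable D) (hk : ∀ z, r < |z| → k z = 0)
    (hD : ∀ z, |z| ≤ r → ENNReal.ofReal (D z ^ 2) ≤ S) :
    hnSq H (fun z => k z * D z) ≤
      2 * (∫⁻ z, ENNReal.ofReal (k z ^ 2) * enDens H r D z) + 2 * S * hnSq H k := by
  have h1 := measurable_wgt H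
  have h2 : Measurable fun p : ℝ × ℝ => bothIn r p.1 p.2 :=
    measurable_bothIn_comp measurable_const measurable_fst measurable_snd
  have h3 : Measurable fun p : ℝ × ℝ => wgt H p.2 := h1.comp measurable_snd
  have m1 : Measurable fun p : ℝ × ℝ => 2 * (ENNReal.ofReal (k p.1 ^ 2) *
      (bothIn r p.1 p.2 * ENNReal.ofReal ((D (p.1 + p.2) - D p.1) ^ 2))) * wgt H p.2 := by
    fun_prop
  have m2 : Measurable fun p : ℝ × ℝ => ENNReal.ofReal ((k (p.1 + p.2) - k p.1) ^ 2)
      * wgt H p.2 := by fun_prop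
  calc hnSq H (fun z => k z * D z)
      ≤ ∫⁻ h : ℝ, ∫⁻ z : ℝ, (2 * (ENNReal.ofReal (k z ^ 2) *
        (bothIn r z h * ENNReal.ofReal ((D (z + h) - D z) ^ 2))) * wgt H h +
        2 * S * (ENNReal.ofReal ((k (z + h) - k z) ^ 2) * wgt H h)) := by
        refine lintegral_mono fun h => lintegral_mono fun z => ?_
        refine (mul_le_mul_left (mul_sub_mul_sq_le hk hD z h) _).trans_eq ?_
        rw [add_mul]; ring
    _ = (∫⁻ h : ℝ, ∫⁻ z : ℝ, 2 * (ENNReal.ofReal (k z ^ 2) *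
        (bothIn r z h * ENNReal.ofReal ((D (z + h) - D z) ^ 2))) * wgt H h) +
        2 * S * hnSq H k := by
        rw [lintegral_lintegral_add (g := fun p => 2 * S *
          (ENNReal.ofReal ((k (p.1 + p.2) - k p.1) ^ 2) * wgt H p.2)) m1]
        congr 1
        unfold hnSq
        rw [← lintegral_const_mul _ m2.lintegral_prod_left']
        refine lintegral_congr fun h => ?_
        exact lintegral_const_mul _ (m2.comp (measurable_id.prodMk measurable_const))
    _ = _ := by
        congr 1
        rw [lintegral_lintegral_swap (f := fun h z => 2 * (ENNReal.ofReal (k z ^ 2) *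
          (bothIn r z h * ENNReal.ofReal ((D (z + h) - D z) ^ 2))) * wgt H h)
          (m1.comp measurable_swap).aemeasurable, ← lintegral_const_mul' _ _ (by simp)]
        refine lintegral_congr fun z => ?_
        unfold enDens
        rw [← mul_assoc, ← lintegral_const_mul' _ _ (by finiteness)]
        refine lintegral_congr fun h => ?_
        ring

/-- The squared norm of `L²([0,T]; 𝓗)`. -/
noncomputable def pathNormSq (H T : ℝ) (φ : ℝ → ℝ → ℝ) : ENNReal :=
  ∫⁻ s in Set.Icc (0 : ℝ) T, HnormSq H (φ s)

/-- The inner product of `L²([0,T]; 𝓗)`. -/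
noncomputable def pathInner (H T : ℝ) (φ ψ : ℝ → ℝ → ℝ) : ℝ :=
  ∫ s in Set.Icc (0 : ℝ) T, Hinner H (φ s) (ψ s)

/-- Weighted increments, which embed `L²([0,T]; 𝓗)` into an `L²` space. -/
noncomputable def wIncr (H : ℝ) (φ : ℝ → ℝ → ℝ) (q : ℝ × ℝ × ℝ) : ℝ :=
  (φ q.1 (q.2.1 + q.2.2) - φ q.1 q.2.1) * |q.2.2| ^ (H - 1)

/-- The measure `1_{[0,T]}(s) ds dz dh`. -/
noncomputable def stripMeasure (T : ℝ) : Measure (ℝ × ℝ × ℝ) :=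
  (volume.restrict (Set.Icc (0 : ℝ) T)).prod volume

instance (T : ℝ) : SFinite (stripMeasure T) := by unfold stripMeasure; infer_instance

lemma rpow_half_mul {H : ℝ} (hH : H < 1) (x : ℝ) :
    |x| ^ (H - 1) * |x| ^ (H - 1) = |x| ^ (2 * H - 2) := by
  rcases eq_or_ne x 0 with rfl | hx
  · rw [abs_zero, Real.zero_rpow (by linarith), Real.zero_rpow (by linarith), mul_zero]
  · rw [← Real.rpow_add (abs_pos.2 hx)]
    congr 1; ring

lemma measurable_wIncr (H : ℝ) {φ : ℝ → ℝ → ℝ} (hφ : Measurable fun q : ℝ × ℝ => φ q.1 q.2) :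
    Measurable (wIncr H φ) := by
  unfold wIncr
  have h1 : Measurable fun q : ℝ × ℝ × ℝ => φ q.1 (q.2.1 + q.2.2) :=
    hφ.comp (f := fun q : ℝ × ℝ × ℝ => (q.1, q.2.1 + q.2.2)) (by fun_prop)
  have h2 : Measurable fun q : ℝ × ℝ × ℝ => φ q.1 q.2.1 :=
    hφ.comp (f := fun q : ℝ × ℝ × ℝ => (q.1, q.2.1)) (by fun_prop)
  fun_prop

lemma pathNormSq_eq {H : ℝ} (hH : H < 1) (T : ℝ) {φ : ℝ → ℝ → ℝ}
    (hφ : Measurable fun q : ℝ × ℝ => φ q.1 q.2) :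
    pathNormSq H T φ = ENNReal.ofReal (c2H H) *
      ∫⁻ q, ENNReal.ofReal (wIncr H φ q ^ 2) ∂(stripMeasure T) := by
  have hm := measurable_wIncr H hφ
  unfold pathNormSq stripMeasure
  simp_rw [HnormSq_eq]
  rw [lintegral_const_mul' _ _ (by simp), lintegral_prod _ (by fun_prop)]
  congr 1
  refine lintegral_congr fun s => ?_
  rw [Measure.volume_eq_prod, lintegral_prod_symm (fun y => ENNReal.ofReal (wIncr H φ (s, y) ^ 2))
    (by fun_prop)]
  unfold hnSq wgt
  refine lintegral_congr fun h => lintegral_congr fun z => ?_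
  rw [← ENNReal.ofReal_mul (sq_nonneg _), ← rpow_half_mul hH]
  congr 1
  simp only [wIncr]
  ring

lemma memLp_wIncr {H T : ℝ} (hH : H ∈ Set.Ioo (1 / 4 : ℝ) (1 / 2 : ℝ)) {φ : ℝ → ℝ → ℝ}
    (hφ : Measurable fun q : ℝ × ℝ => φ q.1 q.2) (hQ : pathNormSq H T φ < ⊤) :
    MemLp (wIncr H φ) 2 (stripMeasure T) := by
  have hm := measurable_wIncr H hφ
  rw [memLp_two_iff_integrable_sq hm.aestronglyMeasurable]
  refine ⟨(hm.pow_const 2).aestronglyMeasurable, ?_⟩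
  rw [hasFiniteIntegral_iff_ofReal (Filter.Eventually.of_forall fun _ => sq_nonneg _)]
  rw [pathNormSq_eq (by linarith [hH.2]) T hφ] at hQ
  by_contra hcon
  rw [not_lt, top_le_iff] at hcon
  rw [hcon, ENNReal.mul_top (by simpa using c2H_pos hH)] at hQ
  exact lt_irrefl _ hQ

lemma pathInner_eq {H T : ℝ} (hH : H ∈ Set.Ioo (1 / 4 : ℝ) (1 / 2 : ℝ)) {φ ψ : ℝ → ℝ → ℝ}
    (hφ : MemLp (wIncr H φ) 2 (stripMeasure T)) (hψ : MemLp (wIncr H ψ) 2 (stripMeasure T)) :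
    pathInner H T φ ψ = c2H H * ∫ q, wIncr H φ q * wIncr H ψ q ∂(stripMeasure T) := by
  have hi : Integrable (fun q => wIncr H φ q * wIncr H ψ q) (stripMeasure T) :=
    hφ.integrable_mul hψ
  unfold pathInner Hinner
  rw [integral_const_mul]
  congr 1
  unfold stripMeasure at hi ⊢
  rw [integral_prod _ hi]
  refine integral_congr_ae (Filter.Eventually.of_forall fun s => ?_)
  refine integral_congr_ae (Filter.Eventually.of_forall fun q => ?_)
  simp only [wIncr]
  rw [← rpow_half_mul (show H < 1 by linarith [hH.2])]
  ring

lemma Hinner_comm (H : ℝ) (φ ψ : ℝ → ℝ) : Hinner H φ ψ = Hinner H ψ φ := by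
  unfold Hinner
  congr 1
  refine integral_congr_ae (Filter.Eventually.of_forall fun q => ?_)
  simp only [mul_comm]

lemma pathInner_comm (H T : ℝ) (φ ψ : ℝ → ℝ → ℝ) :
    pathInner H T φ ψ = pathInner H T ψ φ := by
  unfold pathInner
  simp_rw [fun s => Hinner_comm H (φ s) (ψ s)]

lemma wIncr_sub (H : ℝ) (φ ψ : ℝ → ℝ → ℝ) :
    wIncr H (fun s z => φ s z - ψ s z) = wIncr H φ - wIncr H ψ := by
  funext q
  simp only [wIncr, Pi.sub_apply]
  ring

lemma pathInner_sub_left {H T : ℝ} (hH : H ∈ Set.Ioo (1 / 4 : ℝ) (1 / 2 : ℝ))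
    {φ₁ φ₂ ψ : ℝ → ℝ → ℝ}
    (h₁ : MemLp (wIncr H φ₁) 2 (stripMeasure T)) (h₂ : MemLp (wIncr H φ₂) 2 (stripMeasure T))
    (hψ : MemLp (wIncr H ψ) 2 (stripMeasure T)) :
    pathInner H T (fun s z => φ₁ s z - φ₂ s z) ψ =
      pathInner H T φ₁ ψ - pathInner H T φ₂ ψ := by
  rw [pathInner_eq hH h₁ hψ, pathInner_eq hH h₂ hψ,
    pathInner_eq hH (by rw [wIncr_sub]; exact h₁.sub h₂) hψ, ← mul_sub,
    wIncr_sub]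
  congr 1
  refine Eq.trans ?_ (integral_sub (h₁.integrable_mul hψ) (h₂.integrable_mul hψ))
  simp only [Pi.sub_apply, sub_mul]

lemma pathInner_sub_right {H T : ℝ} (hH : H ∈ Set.Ioo (1 / 4 : ℝ) (1 / 2 : ℝ))
    {φ ψ₁ ψ₂ : ℝ → ℝ → ℝ} (hφ : MemLp (wIncr H φ) 2 (stripMeasure T))
    (h₁ : MemLp (wIncr H ψ₁) 2 (stripMeasure T)) (h₂ : MemLp (wIncr H ψ₂) 2 (stripMeasure T)) :
    pathInner H T φ (fun s z => ψ₁ s z - ψ₂ s z) =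
      pathInner H T φ ψ₁ - pathInner H T φ ψ₂ := by
  rw [pathInner_comm, pathInner_sub_left hH h₁ h₂ hφ, pathInner_comm H T ψ₁,
    pathInner_comm H T ψ₂]

lemma ofReal_integral_mul_sq_le {α : Type*} [MeasurableSpace α] {μ : Measure α} {f g : α → ℝ}
    (hf : AEMeasurable f μ) (hg : AEMeasurable g μ) :
    ENNReal.ofReal ((∫ a, f a * g a ∂μ) ^ 2) ≤
      (∫⁻ a, ENNReal.ofReal (f a ^ 2) ∂μ) * ∫⁻ a, ENNReal.ofReal (g a ^ 2) ∂μ := by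
  have h1 : ‖∫ a, f a * g a ∂μ‖ₑ ≤
      (∫⁻ a, ‖f a‖ₑ ^ (2 : ℝ) ∂μ) ^ (1 / (2 : ℝ)) *
        (∫⁻ a, ‖g a‖ₑ ^ (2 : ℝ) ∂μ) ^ (1 / (2 : ℝ)) := by
    refine (enorm_integral_le_lintegral_enorm _).trans ?_
    simp_rw [enorm_mul]
    exact ENNReal.lintegral_mul_le_Lp_mul_Lq μ (by
      rw [Real.holderConjugate_iff]; norm_num) hf.enorm hg.enorm
  have e : ∀ x : ℝ, ENNReal.ofReal (x ^ 2) = ‖x‖ₑ ^ (2 : ℝ) := by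
    intro x
    rw [← sq_abs, ENNReal.ofReal_pow (abs_nonneg x), ← Real.norm_eq_abs, ofReal_norm]
    norm_cast
  simp_rw [e]
  refine (ENNReal.rpow_le_rpow h1 (by norm_num : (0 : ℝ) ≤ 2)).trans_eq ?_
  rw [ENNReal.mul_rpow_of_nonneg _ _ (by norm_num), ← ENNReal.rpow_mul, ← ENNReal.rpow_mul]
  norm_num

lemma pathInner_sq_le {H T : ℝ} (hH : H ∈ Set.Ioo (1 / 4 : ℝ) (1 / 2 : ℝ)) {φ ψ : ℝ → ℝ → ℝ}
    (hφ : Measurable fun q : ℝ × ℝ => φ q.1 q.2) (hψ : Measurable fun q : ℝ × ℝ => ψ q.1 q.2)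
    (hQφ : pathNormSq H T φ < ⊤) (hQψ : pathNormSq H T ψ < ⊤) :
    ENNReal.ofReal (pathInner H T φ ψ ^ 2) ≤ pathNormSq H T φ * pathNormSq H T ψ := by
  have h1 : H < 1 := by linarith [hH.2]
  have hc := (c2H_pos hH).le
  rw [pathInner_eq hH (memLp_wIncr hH hφ hQφ) (memLp_wIncr hH hψ hQψ), pathNormSq_eq h1 T hφ,
    pathNormSq_eq h1 T hψ, mul_pow, ENNReal.ofReal_mul (sq_nonneg _), ENNReal.ofReal_pow hc]
  refine (mul_le_mul_right (ofReal_integral_mul_sq_le (measurable_wIncr H hφ).aemeasurable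
    (measurable_wIncr H hψ).aemeasurable) _).trans_eq ?_
  ring

lemma pathNormSq_sub_le {H T : ℝ} (hH : H ∈ Set.Ioo (1 / 4 : ℝ) (1 / 2 : ℝ)) {φ ψ : ℝ → ℝ → ℝ}
    (hφ : Measurable fun q : ℝ × ℝ => φ q.1 q.2) (hψ : Measurable fun q : ℝ × ℝ => ψ q.1 q.2) :
    pathNormSq H T (fun s z => φ s z - ψ s z) ≤
      2 * pathNormSq H T φ + 2 * pathNormSq H T ψ := by
  have h1 : H < 1 := by linarith [hH.2]
  have hm := measurable_wIncr H hφ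
  rw [pathNormSq_eq h1 T hφ, pathNormSq_eq h1 T hψ, pathNormSq_eq h1 T (hφ.sub hψ), wIncr_sub]
  have : ∫⁻ q, ENNReal.ofReal ((wIncr H φ - wIncr H ψ) q ^ 2) ∂(stripMeasure T) ≤
      2 * (∫⁻ q, ENNReal.ofReal (wIncr H φ q ^ 2) ∂(stripMeasure T)) +
      2 * ∫⁻ q, ENNReal.ofReal (wIncr H ψ q ^ 2) ∂(stripMeasure T) := by
    refine (lintegral_mono fun y => ofReal_sq_sub_le _ _).trans_eq ?_
    rw [lintegral_add_left (by fun_prop), lintegral_const_mul' _ _ (by simp),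
      lintegral_const_mul' _ _ (by simp)]
  refine (mul_le_mul_right this _).trans_eq ?_
  ring

/-- The kernel `G(t-s,x-z) D(s,z)` of the Duhamel term. -/
noncomputable def mild (D : ℝ → ℝ → ℝ) (t x s z : ℝ) : ℝ := G (t - s) (x - z) * D s z

/-- The supremum of `v(s,·)²` over `[-(R-s), R-s]`. -/
noncomputable def supSq (R : ℝ) (v : ℝ → ℝ → ℝ) (s : ℝ) : ENNReal :=
  ⨆ θ : Set.Icc (-1 : ℝ) 1, ENNReal.ofReal (v s ((R - s) * θ) ^ 2)

/-- The local energy controlled in the Gronwall argument. -/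
noncomputable def coneNorm (H R : ℝ) (v : ℝ → ℝ → ℝ) (s : ℝ) : ENNReal :=
  supSq R v s + enSq H (R - s) (v s)

lemma le_supSq {R s z : ℝ} (v : ℝ → ℝ → ℝ) (hs : s < R) (hz : |z| ≤ R - s) :
    ENNReal.ofReal (v s z ^ 2) ≤ supSq R v s := by
  have h0 : 0 < R - s := by linarith
  have h1 := abs_le.1 hz
  refine le_trans (le_of_eq ?_) (le_iSup _ ⟨z / (R - s), ?_, ?_⟩)
  · simp only
    rw [mul_div_cancel₀ _ h0.ne']
  · rw [le_div_iff₀ h0]; linarith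
  · rw [div_le_one h0]; linarith

lemma supSq_le {R s : ℝ} {v : ℝ → ℝ → ℝ} {c : ENNReal} (hs : s ≤ R)
    (h : ∀ z, |z| ≤ R - s → ENNReal.ofReal (v s z ^ 2) ≤ c) : supSq R v s ≤ c := by
  refine iSup_le fun θ => h _ ?_
  rw [abs_mul, abs_of_nonneg (by linarith : 0 ≤ R - s)]
  have := abs_le.2 θ.2
  nlinarith

lemma measurable_supSq (R : ℝ) {v : ℝ → ℝ → ℝ} (hv : Continuous fun q : ℝ × ℝ => v q.1 q.2) :
    Measurable (supSq R v) := by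
  refine (lowerSemicontinuous_iSup fun θ => ?_).measurable
  apply Continuous.lowerSemicontinuous
  exact ENNReal.continuous_ofReal.comp ((hv.comp
    (f := fun s : ℝ => (s, (R - s) * (θ : ℝ))) (by fun_prop)).pow 2)

lemma measurable_enDens (H R : ℝ) {v : ℝ → ℝ → ℝ}
    (hv : Measurable fun q : ℝ × ℝ => v q.1 q.2) :
    Measurable fun q : ℝ × ℝ => enDens H (R - q.1) (v q.1) q.2 := by
  unfold enDens
  apply Measurable.lintegral_prod_right' (f := fun p : (ℝ × ℝ) × ℝ =>
    bothIn (R - p.1.1) p.1.2 p.2 *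
      ENNReal.ofReal ((v p.1.1 (p.1.2 + p.2) - v p.1.1 p.1.2) ^ 2) * wgt H p.2)
  have h1 : Measurable fun p : (ℝ × ℝ) × ℝ => bothIn (R - p.1.1) p.1.2 p.2 :=
    measurable_bothIn_comp (by fun_prop) (by fun_prop) (by fun_prop)
  have h2 : Measurable fun p : (ℝ × ℝ) × ℝ => wgt H p.2 := (measurable_wgt H).comp measurable_snd
  have h3 : Measurable fun p : (ℝ × ℝ) × ℝ => v p.1.1 (p.1.2 + p.2) :=
    hv.comp (f := fun p : (ℝ × ℝ) × ℝ => (p.1.1, p.1.2 + p.2)) (by fun_prop)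
  have h4 : Measurable fun p : (ℝ × ℝ) × ℝ => v p.1.1 p.1.2 :=
    hv.comp (f := fun p : (ℝ × ℝ) × ℝ => (p.1.1, p.1.2)) (by fun_prop)
  fun_prop

lemma enSq_eq {H R s : ℝ} {v : ℝ → ℝ → ℝ} (hv : Measurable fun q : ℝ × ℝ => v q.1 q.2) :
    enSq H (R - s) (v s) = ∫⁻ z, enDens H (R - s) (v s) z :=
  (lintegral_enDens H (R - s) (hv.comp (measurable_const.prodMk measurable_id))).symm

lemma measurable_enSq (H R : ℝ) {v : ℝ → ℝ → ℝ}
    (hv : Measurable fun q : ℝ × ℝ => v q.1 q.2) :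
    Measurable fun s => enSq H (R - s) (v s) := by
  simp_rw [fun s => enSq_eq (H := H) (R := R) (s := s) hv]
  exact (measurable_enDens H R hv).lintegral_prod_right'

lemma measurable_coneNorm (H R : ℝ) {v : ℝ → ℝ → ℝ}
    (hv : Continuous fun q : ℝ × ℝ => v q.1 q.2) : Measurable (coneNorm H R v) :=
  (measurable_supSq R hv).add (measurable_enSq H R hv.measurable)

lemma G_sub_eq (τ x z : ℝ) : G τ (x - z) = halfInd (x - τ) (x + τ) z := by
  unfold G halfInd
  simp only [abs_lt]
  congr 1
  apply propext
  constructor <;> rintro ⟨h1, h2⟩ <;> constructor <;> linarith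

lemma G_sub_eq' (τ x z : ℝ) : G τ (x - z) = halfInd (z - τ) (z + τ) x := by
  rw [← G_sub_eq, G, G, abs_sub_comm]

lemma G_eq_zero {τ x : ℝ} (h : τ ≤ |x|) : G τ x = 0 := if_neg (not_lt.2 h)

lemma measurable_G : Measurable fun q : ℝ × ℝ => G q.1 q.2 :=
  Measurable.ite (measurableSet_lt (by fun_prop) measurable_fst) measurable_const
    measurable_const

lemma measurable_G_comp {α : Type*} [MeasurableSpace α] {τ x : α → ℝ}
    (hτ : Measurable τ) (hx : Measurable x) : Measurable fun p => G (τ p) (x p) :=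
  measurable_G.comp (hτ.prodMk hx)

lemma measurable_mild {D : ℝ → ℝ → ℝ} (hD : Measurable fun q : ℝ × ℝ => D q.1 q.2) (t x : ℝ) :
    Measurable fun q : ℝ × ℝ => mild D t x q.1 q.2 :=
  (measurable_G_comp (by fun_prop) (by fun_prop)).mul hD

lemma hnSq_mild_sub_le {H R s t x t' x' : ℝ} {D : ℝ → ℝ → ℝ}
    (hD : Measurable fun q : ℝ × ℝ => D q.1 q.2) (hs : s < R)
    (hx : |x| ≤ R - t) (hx' : |x'| ≤ R - t') :
    hnSq H (fun z => mild D t x s z - mild D t' x' s z) ≤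
      2 * (∫⁻ z, ENNReal.ofReal ((G (t - s) (x - z) - G (t' - s) (x' - z)) ^ 2) *
        enDens H (R - s) (D s) z) +
      16 * wgtConst H * ENNReal.ofReal (√(2 * (|x - x'| + |t - t'|)) +
        2 * (|x - x'| + |t - t'|)) * supSq R D s := by
  have hDs : Measurable (D s) := hD.comp (measurable_const.prodMk measurable_id)
  have hkm : Measurable fun z => G (t - s) (x - z) - G (t' - s) (x' - z) :=
    (measurable_G_comp measurable_const (by fun_prop)).sub
      (measurable_G_comp measurable_const (by fun_prop))
  have far : ∀ {t x z : ℝ}, |x| ≤ R - t → R - s < |z| → t - s ≤ |x - z| := by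
    intro t x z h1 h2
    have := abs_sub_abs_le_abs_sub z x
    rw [abs_sub_comm] at this
    linarith
  have h1 := hnSq_mul_le (H := H) (r := R - s) (S := supSq R D s) hkm hDs
    (fun z hz => by rw [G_eq_zero (far hx hz), G_eq_zero (far hx' hz), sub_zero])
    (fun z hz => le_supSq D hs hz)
  have e : (fun z => mild D t x s z - mild D t' x' s z) =
      fun z => (G (t - s) (x - z) - G (t' - s) (x' - z)) * D s z := by
    funext z; simp only [mild]; ring
  rw [e]
  refine h1.trans (add_le_add_right ?_ _)
  have h2 := hnSq_halfInd_sub_le H (x - (t - s)) (x + (t - s)) (x' - (t' - s)) (x' + (t' - s))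
  simp_rw [G_sub_eq]
  refine (mul_le_mul_right h2 _).trans ?_
  set d := |x - (t - s) - (x' - (t' - s))| + |x + (t - s) - (x' + (t' - s))| with hd
  have hd' : d ≤ 2 * (|x - x'| + |t - t'|) := by
    have e1 : x - (t - s) - (x' - (t' - s)) = (x - x') - (t - t') := by ring
    have e2 : x + (t - s) - (x' + (t' - s)) = (x - x') + (t - t') := by ring
    rw [hd, e1, e2]
    linarith [abs_sub (x - x') (t - t'), abs_add_le (x - x') (t - t')]
  have h3 : ENNReal.ofReal (√d + d) ≤ ENNReal.ofReal (√(2 * (|x - x'| + |t - t'|)) +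
        2 * (|x - x'| + |t - t'|)) :=
    ENNReal.ofReal_le_ofReal (add_le_add (Real.sqrt_le_sqrt hd') hd')
  calc _ ≤ 2 * supSq R D s * (8 * wgtConst H * ENNReal.ofReal (√(2 * (|x - x'| + |t - t'|)) +
        2 * (|x - x'| + |t - t'|))) := by gcongr
    _ = _ := by ring

lemma pathNormSq_mild_sub_le {H R T t₁ t x t' x' : ℝ} {D : ℝ → ℝ → ℝ}
    (hD : Continuous fun q : ℝ × ℝ => D q.1 q.2) (hR : T < R)
    (ht : t ≤ t₁) (ht' : t' ≤ t₁) (ht₁ : t₁ ≤ T)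
    (hx : |x| ≤ R - t) (hx' : |x'| ≤ R - t') :
    pathNormSq H T (fun s z => mild D t x s z - mild D t' x' s z) ≤
      ENNReal.ofReal (c2H H) * (2 * (∫⁻ s in Set.Icc (0 : ℝ) t₁,
        ∫⁻ z, ENNReal.ofReal ((G (t - s) (x - z) - G (t' - s) (x' - z)) ^ 2) *
        enDens H (R - s) (D s) z) +
      16 * wgtConst H * ENNReal.ofReal (√(2 * (|x - x'| + |t - t'|)) +
        2 * (|x - x'| + |t - t'|)) * ∫⁻ s in Set.Icc (0 : ℝ) t₁, supSq R D s) := by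
  unfold pathNormSq
  have hsup := measurable_supSq R hD
  have hzero : ∀ s, t₁ < s →
      HnormSq H (fun z => mild D t x s z - mild D t' x' s z) = 0 := by
    intro s hs
    have : ∀ z, mild D t x s z - mild D t' x' s z = 0 := by
      intro z
      simp only [mild]
      rw [G_eq_zero (le_trans (by linarith) (abs_nonneg _)),
        G_eq_zero (le_trans (by linarith) (abs_nonneg _))]
      ring
    simp [HnormSq, this]
  calc _ ≤ ∫⁻ s in Set.Icc (0 : ℝ) T, (Set.Icc (0 : ℝ) t₁).indicator
        (fun s => HnormSq H (fun z => mild D t x s z - mild D t' x' s z)) s := by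
        refine setLIntegral_mono' measurableSet_Icc fun s hs => ?_
        by_cases h : s ≤ t₁
        · rw [Set.indicator_of_mem (show s ∈ Set.Icc (0 : ℝ) t₁ from ⟨hs.1, h⟩)]
        · rw [hzero s (not_le.1 h)]; exact zero_le
    _ ≤ ∫⁻ s in Set.Icc (0 : ℝ) t₁,
        HnormSq H (fun z => mild D t x s z - mild D t' x' s z) := by
        rw [lintegral_indicator measurableSet_Icc]
        exact lintegral_mono' (Measure.restrict_mono_measure Measure.restrict_le_self _) le_rfl
    _ ≤ ∫⁻ s in Set.Icc (0 : ℝ) t₁, ENNReal.ofReal (c2H H) * (2 * (∫⁻ z,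
          ENNReal.ofReal ((G (t - s) (x - z) - G (t' - s) (x' - z)) ^ 2) *
        enDens H (R - s) (D s) z) +
        16 * wgtConst H * ENNReal.ofReal (√(2 * (|x - x'| + |t - t'|)) +
        2 * (|x - x'| + |t - t'|)) * supSq R D s) := by
        refine setLIntegral_mono' measurableSet_Icc fun s hs => ?_
        rw [HnormSq_eq]
        exact mul_le_mul_right (hnSq_mild_sub_le hD.measurable
          (lt_of_le_of_lt (hs.2.trans ht₁) hR) hx hx') _
    _ = _ := by
        rw [lintegral_const_mul' _ _ (by simp), lintegral_add_right _ (by fun_prop),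
          lintegral_const_mul' _ _ (by simp), lintegral_const_mul _ hsup]

lemma ofReal_G_sub_sq_le_one (a b c d : ℝ) : ENNReal.ofReal ((G a b - G c d) ^ 2) ≤ 1 := by
  rw [ENNReal.ofReal_le_one]
  unfold G
  split_ifs <;> norm_num

lemma lintegral_enSq_le {H R : ℝ} (t : ℝ) (D : ℝ → ℝ → ℝ) :
    ∫⁻ s in Set.Icc (0 : ℝ) t, enSq H (R - s) (D s) ≤
      ∫⁻ s in Set.Icc (0 : ℝ) t, coneNorm H R D s :=
  lintegral_mono fun _ => le_add_self

lemma lintegral_supSq_le {H R : ℝ} (t : ℝ) (D : ℝ → ℝ → ℝ) :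
    ∫⁻ s in Set.Icc (0 : ℝ) t, supSq R D s ≤
      ∫⁻ s in Set.Icc (0 : ℝ) t, coneNorm H R D s :=
  lintegral_mono fun _ => le_self_add

lemma exists_pathNormSq_mild_le {H R T : ℝ} (hH : H ∈ Set.Ioo (1 / 4 : ℝ) (1 / 2 : ℝ))
    (hR : T < R) : ∃ K : ENNReal, K ≠ ⊤ ∧ ∀ D : ℝ → ℝ → ℝ,
      (Continuous fun q : ℝ × ℝ => D q.1 q.2) → ∀ t ∈ Set.Icc (0 : ℝ) T, ∀ x, |x| ≤ R - t →
      pathNormSq H T (mild D t x) ≤ K * ∫⁻ s in Set.Icc (0 : ℝ) t, coneNorm H R D s := by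
  have hw := (wgtConst_lt_top hH).ne
  refine ⟨ENNReal.ofReal (c2H H) * (2 + 16 * wgtConst H * ENNReal.ofReal (√(2 * T) + 2 * T)),
    by finiteness, ?_⟩
  intro D hD t ht x hx
  have e : pathNormSq H T (mild D t x) =
      pathNormSq H T (fun s z => mild D t x s z - mild D 0 x s z) := by
    unfold pathNormSq
    refine setLIntegral_congr_fun measurableSet_Icc fun s hs => ?_
    have : ∀ z, mild D 0 x s z = 0 := fun z => by
      rw [mild, G_eq_zero (le_trans (by linarith [hs.1]) (abs_nonneg _)), zero_mul]
    simp only [this, sub_zero]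
  rw [e]
  refine (pathNormSq_mild_sub_le hD hR le_rfl ht.1 ht.2 hx (by linarith [ht.1])).trans ?_
  set A := ∫⁻ s in Set.Icc (0 : ℝ) t, coneNorm H R D s with hA
  have h1 : ∫⁻ s in Set.Icc (0 : ℝ) t, ∫⁻ z,
      ENNReal.ofReal ((G (t - s) (x - z) - G (0 - s) (x - z)) ^ 2) *
        enDens H (R - s) (D s) z ≤ A := by
    refine le_trans (lintegral_mono fun s => ?_) (lintegral_enSq_le t D)
    rw [enSq_eq hD.measurable]
    exact lintegral_mono fun z => (mul_le_mul_left (ofReal_G_sub_sq_le_one _ _ _ _) _).trans_eq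
      (one_mul _)
  have h2 : ENNReal.ofReal (√(2 * (|x - x| + |t - 0|)) + 2 * (|x - x| + |t - 0|)) ≤
      ENNReal.ofReal (√(2 * T) + 2 * T) := by
    apply ENNReal.ofReal_le_ofReal
    rw [sub_self, abs_zero, zero_add, sub_zero, abs_of_nonneg ht.1]
    have : 2 * t ≤ 2 * T := by linarith [ht.2]
    exact add_le_add (Real.sqrt_le_sqrt this) this
  calc _ ≤ ENNReal.ofReal (c2H H) * (2 * A +
        16 * wgtConst H * ENNReal.ofReal (√(2 * T) + 2 * T) * A) := by
        gcongr
        exact lintegral_supSq_le t D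
    _ = _ := by ring

lemma bothIn_eq_zero {r z h : ℝ} (h' : 2 * r < |h|) : bothIn r z h = 0 := by
  unfold bothIn
  rw [if_neg]
  rintro ⟨h1, h2⟩
  have := abs_sub (z + h) z
  rw [add_sub_cancel_left] at this
  linarith

lemma lintegral_bothIn_le (r h : ℝ) : ∫⁻ x, bothIn r x h ≤ ENNReal.ofReal (2 * r) := by
  calc _ ≤ ∫⁻ x, (Set.Icc (-r) r).indicator 1 x := by
        refine lintegral_mono fun x => ?_
        unfold bothIn
        split_ifs with h1
        · rw [Set.indicator_of_mem (show x ∈ Set.Icc (-r) r from abs_le.1 h1.1)]; rfl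
        · exact zero_le
    _ = _ := by
        rw [lintegral_indicator_one measurableSet_Icc, Real.volume_Icc]
        congr 1; ring

lemma lintegral_G_shift_sub_sq_le (τ h z : ℝ) :
    ∫⁻ x, ENNReal.ofReal ((G τ (x + h - z) - G τ (x - z)) ^ 2) ≤ ENNReal.ofReal (2 * |h|) := by
  simp_rw [G_sub_eq', halfInd_add]
  refine (lintegral_halfInd_sub_sq_le _ _ _ _).trans_eq ?_
  congr 1
  simp [two_mul]

lemma sqrt_add_le_mul_sqrt_min {R h : ℝ} (hh : |h| ≤ 2 * R) :
    √(2 * |h|) + 2 * |h| ≤ 4 * (1 + 2 * R) * √(min |h| 1) := by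
  have h0 := abs_nonneg h
  set y := |h|
  have h1 : √(2 * y) ≤ 2 * √y := by
    rw [Real.sqrt_mul (by norm_num)]
    have : √2 ≤ 2 := by rw [Real.sqrt_le_left (by norm_num)]; norm_num
    exact mul_le_mul_of_nonneg_right this (Real.sqrt_nonneg _)
  have h2 := Real.sqrt_nonneg y
  have h3 := Real.mul_self_sqrt h0
  rcases le_total y 1 with h4 | h4
  · rw [min_eq_left h4]
    have : √y ≤ 1 := by rw [Real.sqrt_le_left (by norm_num)]; simpa using h4
    nlinarith
  · rw [min_eq_right h4, Real.sqrt_one]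
    have : 1 ≤ √y := by rw [Real.one_le_sqrt]; exact h4
    nlinarith

lemma exists_enSq_pathNormSq_mild_le {H R T : ℝ} (hH : H ∈ Set.Ioo (1 / 4 : ℝ) (1 / 2 : ℝ))
    (hR : T < R) : ∃ K : ENNReal, K ≠ ⊤ ∧ ∀ D : ℝ → ℝ → ℝ,
      (Continuous fun q : ℝ × ℝ => D q.1 q.2) → ∀ t ∈ Set.Icc (0 : ℝ) T,
      ∫⁻ h, ∫⁻ x, bothIn (R - t) x h * pathNormSq H T
        (fun s z => mild D t (x + h) s z - mild D t x s z) * wgt H h ≤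
      K * ∫⁻ s in Set.Icc (0 : ℝ) t, coneNorm H R D s := by
  have hw := (wgtConst_lt_top hH).ne
  refine ⟨ENNReal.ofReal (c2H H) * (2 * ENNReal.ofReal (4 * (1 + 2 * R)) + 16 * wgtConst H *
    ENNReal.ofReal (4 * (1 + 2 * R)) * ENNReal.ofReal (2 * R)) * wgtConst H,
    by finiteness, ?_⟩
  intro D hD t ht
  set A := ∫⁻ s in Set.Icc (0 : ℝ) t, coneNorm H R D s with hA
  have hen := measurable_enDens H R hD.measurable
  let I : ℝ → ℝ → ENNReal := fun h x => ∫⁻ s in Set.Icc (0 : ℝ) t, ∫⁻ z,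
      ENNReal.ofReal ((G (t - s) (x + h - z) - G (t - s) (x - z)) ^ 2) *
        enDens H (R - s) (D s) z
  have hI : ∀ h, ∫⁻ x, I h x ≤ ENNReal.ofReal (2 * |h|) * A := by
    intro h
    have m : Measurable fun p : ℝ × ℝ × ℝ =>
        ENNReal.ofReal ((G (t - p.2.1) (p.1 + h - p.2.2) - G (t - p.2.1) (p.1 - p.2.2)) ^ 2) *
          enDens H (R - p.2.1) (D p.2.1) p.2.2 := by
      have m1 : Measurable fun p : ℝ × ℝ × ℝ => G (t - p.2.1) (p.1 + h - p.2.2) :=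
        measurable_G_comp (by fun_prop) (by fun_prop)
      have m2 : Measurable fun p : ℝ × ℝ × ℝ => G (t - p.2.1) (p.1 - p.2.2) :=
        measurable_G_comp (by fun_prop) (by fun_prop)
      have m3 : Measurable fun p : ℝ × ℝ × ℝ => enDens H (R - p.2.1) (D p.2.1) p.2.2 :=
        hen.comp measurable_snd
      fun_prop
    calc ∫⁻ x, I h x = ∫⁻ x : ℝ, ∫⁻ q : ℝ × ℝ,
          ENNReal.ofReal ((G (t - q.1) (x + h - q.2) - G (t - q.1) (x - q.2)) ^ 2) *
          enDens H (R - q.1) (D q.1) q.2 ∂((volume.restrict (Set.Icc (0 : ℝ) t)).prod volume) := by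
          refine lintegral_congr fun x => ?_
          exact (lintegral_prod _ (m.comp measurable_prodMk_left).aemeasurable).symm
      _ = ∫⁻ q : ℝ × ℝ, (∫⁻ x,
          ENNReal.ofReal ((G (t - q.1) (x + h - q.2) - G (t - q.1) (x - q.2)) ^ 2) *
          enDens H (R - q.1) (D q.1) q.2) ∂((volume.restrict (Set.Icc (0 : ℝ) t)).prod volume) :=
          lintegral_lintegral_swap m.aemeasurable
      _ ≤ ∫⁻ q : ℝ × ℝ, ENNReal.ofReal (2 * |h|) * enDens H (R - q.1) (D q.1) q.2
            ∂((volume.restrict (Set.Icc (0 : ℝ) t)).prod volume) := by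
          refine lintegral_mono fun q => ?_
          have m4 : Measurable fun x => ENNReal.ofReal
              ((G (t - q.1) (x + h - q.2) - G (t - q.1) (x - q.2)) ^ 2) :=
            (((measurable_G_comp measurable_const (by fun_prop)).sub
              (measurable_G_comp measurable_const (by fun_prop))).pow_const 2).ennreal_ofReal
          simp only
          rw [lintegral_mul_const _ m4]
          exact mul_le_mul_left (lintegral_G_shift_sub_sq_le _ _ _) _
      _ ≤ _ := by
          rw [lintegral_const_mul _ hen, lintegral_prod _ hen.aemeasurable]
          refine mul_le_mul_right (le_trans (le_of_eq ?_) (lintegral_enSq_le t D)) _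
          exact lintegral_congr fun s => (enSq_eq hD.measurable).symm
  set κ := ENNReal.ofReal (4 * (1 + 2 * R)) with hκ
  have main : ∀ h, ∫⁻ x, bothIn (R - t) x h * pathNormSq H T
        (fun s z => mild D t (x + h) s z - mild D t x s z) * wgt H h ≤
      ENNReal.ofReal (c2H H) * (2 * κ + 16 * wgtConst H * κ * ENNReal.ofReal (2 * R)) * A *
        (ENNReal.ofReal (√(min |h| 1)) * wgt H h) := by
    intro h
    rw [lintegral_mul_const' _ _ (by simp [wgt]), ← mul_assoc]
    refine mul_le_mul_left ?_ _
    rcases lt_or_ge (2 * R) |h| with hh | hh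
    · have : ∀ x, bothIn (R - t) x h = 0 := fun x => bothIn_eq_zero (by linarith [ht.1])
      simp [this]
    set m := ENNReal.ofReal (√(min |h| 1))
    have hρ : ENNReal.ofReal (√(2 * |h|) + 2 * |h|) ≤ κ * m := by
      rw [hκ, ← ENNReal.ofReal_mul (by linarith [ht.1, ht.2])]
      exact ENNReal.ofReal_le_ofReal (sqrt_add_le_mul_sqrt_min hh)
    have hρ' : ENNReal.ofReal (2 * |h|) ≤ κ * m := le_trans (ENNReal.ofReal_le_ofReal
      (by linarith [Real.sqrt_nonneg (2 * |h|)])) hρ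
    have hb : Measurable fun x => bothIn (R - t) x h :=
      measurable_bothIn_comp measurable_const measurable_id measurable_const
    calc _ ≤ ∫⁻ x, (ENNReal.ofReal (c2H H) * 2 * I h x + ENNReal.ofReal (c2H H) *
          (16 * wgtConst H * (κ * m) * A) * bothIn (R - t) x h) := by
          refine lintegral_mono fun x => ?_
          by_cases hx : |x| ≤ R - t ∧ |x + h| ≤ R - t
          · have := pathNormSq_mild_sub_le (H := H) hD hR le_rfl le_rfl ht.2 hx.2 hx.1
            simp only [bothIn, hx, and_self, if_true, one_mul, mul_one]
            refine this.trans ?_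
            rw [add_sub_cancel_left, sub_self, abs_zero, add_zero, mul_assoc _ (2 : ENNReal), ← mul_add]
            gcongr
            exact lintegral_supSq_le t D
          · simp only [bothIn, hx, if_false, zero_mul]
            exact zero_le
      _ ≤ ENNReal.ofReal (c2H H) * 2 * (κ * m * A) + ENNReal.ofReal (c2H H) *
          (16 * wgtConst H * (κ * m) * A) * ENNReal.ofReal (2 * R) := by
          rw [lintegral_add_right _ (by fun_prop), lintegral_const_mul' _ _ (by finiteness),
            lintegral_const_mul _ hb]
          gcongr
          · exact (hI h).trans (mul_le_mul_left hρ' _)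
          · exact (lintegral_bothIn_le _ _).trans
              (ENNReal.ofReal_le_ofReal (by linarith [ht.1]))
      _ = _ := by ring
  have hm : Measurable fun h : ℝ => ENNReal.ofReal (√(min |h| 1)) * wgt H h := by
    have := measurable_wgt H
    fun_prop
  refine (lintegral_mono main).trans ?_
  rw [lintegral_const_mul _ hm]
  refine le_of_eq ?_
  unfold wgtConst
  ring

lemma lintegral_coneNorm_mono {H R T : ℝ} {t : ℝ} (ht : t ∈ Set.Icc (0 : ℝ) T) (D : ℝ → ℝ → ℝ) :
    ∫⁻ s in Set.Icc (0 : ℝ) t, coneNorm H R D s ≤ ∫⁻ s in Set.Icc (0 : ℝ) T, coneNorm H R D s :=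
  lintegral_mono_set (Set.Icc_subset_Icc_right ht.2)

lemma exists_coneNorm_pathInner_le {H R T : ℝ} (hH : H ∈ Set.Ioo (1 / 4 : ℝ) (1 / 2 : ℝ))
    (hR : T < R) : ∃ K : ENNReal, K ≠ ⊤ ∧ ∀ D : ℝ → ℝ → ℝ,
      (Continuous fun q : ℝ × ℝ => D q.1 q.2) →
      ∫⁻ s in Set.Icc (0 : ℝ) T, coneNorm H R D s < ⊤ →
      ∀ g : ℝ → ℝ → ℝ, (Measurable fun q : ℝ × ℝ => g q.1 q.2) →
      ∀ M : ENNReal, M ≠ ⊤ → pathNormSq H T g ≤ M → ∀ t ∈ Set.Icc (0 : ℝ) T,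
      coneNorm H R (fun t x => pathInner H T (mild D t x) g) t ≤
        K * M * ∫⁻ s in Set.Icc (0 : ℝ) t, coneNorm H R D s := by
  obtain ⟨K₁, hK₁, h₁⟩ := exists_pathNormSq_mild_le hH hR
  obtain ⟨K₂, hK₂, h₂⟩ := exists_enSq_pathNormSq_mild_le hH hR
  refine ⟨K₁ + K₂, by finiteness, ?_⟩
  intro D hD hDT g hg M hM hgM t ht
  set A := ∫⁻ s in Set.Icc (0 : ℝ) t, coneNorm H R D s with hA
  have hAT : A < ⊤ := (lintegral_coneNorm_mono ht D).trans_lt hDT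
  have hgT : pathNormSq H T g < ⊤ := hgM.trans_lt hM.lt_top
  have hfin : ∀ x, |x| ≤ R - t → pathNormSq H T (mild D t x) < ⊤ := fun x hx =>
    (h₁ D hD t ht x hx).trans_lt (by finiteness)
  have hmild := fun x => measurable_mild hD.measurable t x
  rw [add_mul, add_mul]
  refine add_le_add (supSq_le (ht.2.trans hR.le) fun z hz => ?_) ?_
  · refine (pathInner_sq_le hH (hmild z) hg (hfin z hz) hgT).trans ?_
    calc _ ≤ K₁ * A * M := mul_le_mul' (h₁ D hD t ht z hz) hgM
      _ = _ := by ring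
  · calc _ ≤ ∫⁻ h, ∫⁻ x, M * (bothIn (R - t) x h * pathNormSq H T
            (fun s z => mild D t (x + h) s z - mild D t x s z) * wgt H h) := by
          refine lintegral_mono fun h => lintegral_mono fun x => ?_
          by_cases hx : |x| ≤ R - t ∧ |x + h| ≤ R - t
          · simp only
            rw [← mul_assoc, mul_left_comm M]
            refine mul_le_mul_left (mul_le_mul_right ?_ _) _
            have f1 := hfin x hx.1
            have f2 := hfin (x + h) hx.2
            rw [← pathInner_sub_left hH (memLp_wIncr hH (hmild _) f2)
              (memLp_wIncr hH (hmild _) f1) (memLp_wIncr hH hg hgT), mul_comm M]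
            refine (pathInner_sq_le hH ((hmild _).sub (hmild _)) hg ?_ hgT).trans ?_
            · exact (pathNormSq_sub_le hH (hmild _) (hmild _)).trans_lt (by finiteness)
            · exact mul_le_mul_right hgM _
          · simp only [bothIn, hx, if_false, zero_mul]
            exact zero_le
      _ = M * ∫⁻ h, ∫⁻ x, bothIn (R - t) x h * pathNormSq H T
            (fun s z => mild D t (x + h) s z - mild D t x s z) * wgt H h := by
          rw [← lintegral_const_mul' _ _ hM]
          exact lintegral_congr fun h => lintegral_const_mul' _ _ hM
      _ ≤ M * (K₂ * A) := mul_le_mul_right (h₂ D hD t ht) _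
      _ = _ := by ring

/-- The truncated backward cone `{(t,x) : 0 ≤ t ≤ T, |x| ≤ R - t}`. -/
def cone (R T : ℝ) : Set (ℝ × ℝ) := {p | p.1 ∈ Set.Icc (0 : ℝ) T ∧ |p.2| ≤ R - p.1}

lemma isCompact_cone (R T : ℝ) : IsCompact (cone R T) := by
  apply IsCompact.of_isClosed_subset (isCompact_Icc.prod (isCompact_Icc (a := -R) (b := R)))
  · exact (isClosed_Icc.preimage continuous_fst).inter
      (isClosed_le (f := fun p : ℝ × ℝ => |p.2|) (g := fun p => R - p.1) (by fun_prop)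
        (by fun_prop))
  · rintro ⟨t, x⟩ ⟨h1, h2⟩
    exact ⟨h1, abs_le.1 (h2.trans (by linarith [h1.1]))⟩

lemma tendsto_G_sub {τ y : ℝ} (h : |y| ≠ τ) :
    ∀ᶠ p : ℝ × ℝ in nhds (τ, y), G p.1 p.2 = G τ y := by
  unfold G
  rcases lt_or_gt_of_ne h with h | h
  · filter_upwards [(isOpen_lt (f := fun p : ℝ × ℝ => |p.2|) (g := fun p => p.1)
      (by fun_prop) (by fun_prop)).mem_nhds h] with p hp
    rw [if_pos hp, if_pos h]
  · filter_upwards [(isOpen_lt (f := fun p : ℝ × ℝ => p.1) (g := fun p => |p.2|)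
      (by fun_prop) (by fun_prop)).mem_nhds h] with p hp
    rw [if_neg (not_lt.2 (le_of_lt hp)), if_neg (not_lt.2 h.le)]

lemma tendsto_pathNormSq_mild_sub {H R T : ℝ} (hH : H ∈ Set.Ioo (1 / 4 : ℝ) (1 / 2 : ℝ))
    (hR : T < R) {D : ℝ → ℝ → ℝ} (hD : Continuous fun q : ℝ × ℝ => D q.1 q.2)
    (hDT : ∫⁻ s in Set.Icc (0 : ℝ) T, coneNorm H R D s < ⊤) {p₀ : ℝ × ℝ} (hp₀ : p₀ ∈ cone R T) :
    Filter.Tendsto (fun p : ℝ × ℝ => pathNormSq H T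
      (fun s z => mild D p.1 p.2 s z - mild D p₀.1 p₀.2 s z))
      (nhdsWithin p₀ (cone R T)) (nhds 0) := by
  have hw := (wgtConst_lt_top hH).ne
  have hen := measurable_enDens H R hD.measurable
  let μ : Measure (ℝ × ℝ) := (volume.restrict (Set.Icc (0 : ℝ) T)).prod volume
  let F : ℝ × ℝ → ℝ × ℝ → ENNReal := fun p q =>
    ENNReal.ofReal ((G (p.1 - q.1) (p.2 - q.2) - G (p₀.1 - q.1) (p₀.2 - q.2)) ^ 2) *
      enDens H (R - q.1) (D q.1) q.2
  have hF : ∀ p, Measurable (F p) := by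
    intro p
    have m1 : ∀ p : ℝ × ℝ, Measurable fun q : ℝ × ℝ => G (p.1 - q.1) (p.2 - q.2) := fun p =>
      measurable_G_comp (by fun_prop) (by fun_prop)
    have := m1 p
    have := m1 p₀
    fun_prop
  have hnull : ∀ᵐ q ∂μ, |p₀.2 - q.2| ≠ p₀.1 - q.1 := by
    rw [ae_iff]
    simp only [ne_eq, not_not]
    rw [Measure.measure_prod_null
      (measurableSet_eq_fun (by fun_prop) (by fun_prop))]
    refine Filter.Eventually.of_forall fun s => ?_
    refine Set.Finite.measure_zero (Set.Finite.subset
      (Set.toFinite {p₀.2 - (p₀.1 - s), p₀.2 + (p₀.1 - s)}) ?_) _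
    intro z hz
    simp only [Set.mem_preimage, Set.mem_ofPred_eq] at hz
    simp only [Set.mem_insert_iff, Set.mem_singleton_iff]
    rcases abs_choice (p₀.2 - z) with h | h
    · left; linarith
    · right; linarith
  have hJ : Filter.Tendsto (fun p => ∫⁻ q, F p q ∂μ) (nhds p₀) (nhds 0) := by
    have : Filter.Tendsto (fun p => ∫⁻ q, F p q ∂μ) (nhds p₀) (nhds (∫⁻ _, 0 ∂μ)) := by
      refine tendsto_lintegral_filter_of_dominated_convergence
        (fun q => enDens H (R - q.1) (D q.1) q.2) (Filter.Eventually.of_forall hF) ?_ ?_ ?_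
      · exact Filter.Eventually.of_forall fun p => Filter.Eventually.of_forall fun q =>
          (mul_le_mul_left (ofReal_G_sub_sq_le_one _ _ _ _) _).trans_eq (one_mul _)
      · rw [lintegral_prod _ hen.aemeasurable]
        simp_rw [fun s => (enSq_eq (H := H) (R := R) (s := s) hD.measurable).symm]
        exact ((lintegral_enSq_le T D).trans_lt hDT).ne
      · filter_upwards [hnull] with q hq
        have hc : Filter.Tendsto (fun p : ℝ × ℝ => (p.1 - q.1, p.2 - q.2)) (nhds p₀)
            (nhds (p₀.1 - q.1, p₀.2 - q.2)) :=
          Continuous.tendsto (f := fun p : ℝ × ℝ => (p.1 - q.1, p.2 - q.2)) (by fun_prop) p₀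
        refine tendsto_const_nhds.congr' ?_
        filter_upwards [hc.eventually (tendsto_G_sub hq)] with p hp
        simp only [F]
        rw [hp]
        simp
    simpa using this
  let d : ℝ × ℝ → ℝ := fun p => |p.2 - p₀.2| + |p.1 - p₀.1|
  have hd : Filter.Tendsto (fun p => ENNReal.ofReal (√(2 * d p) + 2 * d p)) (nhds p₀)
      (nhds 0) := by
    have hc : Continuous fun p => ENNReal.ofReal (√(2 * d p) + 2 * d p) :=
      ENNReal.continuous_ofReal.comp (by fun_prop)
    have := hc.tendsto p₀
    simpa [d] using this
  set S := ∫⁻ s in Set.Icc (0 : ℝ) T, supSq R D s with hS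
  have hST : S ≠ ⊤ := ((lintegral_supSq_le T D).trans_lt hDT).ne
  have hlim : Filter.Tendsto (fun p => ENNReal.ofReal (c2H H) * (2 * (∫⁻ q, F p q ∂μ) +
      16 * wgtConst H * ENNReal.ofReal (√(2 * d p) + 2 * d p) * S)) (nhds p₀) (nhds 0) := by
    have l1 := ENNReal.Tendsto.const_mul (a := 2) hJ (Or.inr (by simp))
    have l2 := ENNReal.Tendsto.mul_const (b := S) (ENNReal.Tendsto.const_mul
      (a := 16 * wgtConst H) hd (Or.inr (by finiteness))) (Or.inr hST)
    have l3 := ENNReal.Tendsto.const_mul (a := ENNReal.ofReal (c2H H)) (l1.add l2)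
      (Or.inr (by simp))
    simpa using l3
  refine tendsto_of_tendsto_of_tendsto_of_le_of_le' tendsto_const_nhds
    (hlim.mono_left nhdsWithin_le_nhds) (Filter.Eventually.of_forall fun _ => zero_le) ?_
  filter_upwards [self_mem_nhdsWithin] with p hp
  refine (pathNormSq_mild_sub_le hD hR hp.1.2 hp₀.1.2 le_rfl hp.2 hp₀.2).trans_eq ?_
  rw [lintegral_prod _ (hF p).aemeasurable]

lemma lintegral_exp_neg_Ici {l : ℝ} (hl : 0 < l) (s : ℝ) :
    ∫⁻ t in Set.Ici s, ENNReal.ofReal (Real.exp (-l * t)) =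
      ENNReal.ofReal (Real.exp (-l * s) / l) := by
  rw [setLIntegral_congr Ioi_ae_eq_Ici.symm, ← ofReal_integral_eq_lintegral_ofReal
    (integrableOn_exp_mul_Ioi (by linarith) s)
    (Filter.Eventually.of_forall fun _ => (Real.exp_pos _).le),
    integral_exp_mul_Ioi (by linarith) s, div_neg, neg_div, neg_neg]

lemma lintegral_le_of_gronwall {c T : ℝ} (hc : 0 < c) {N f : ℝ → ENNReal} (hN : Measurable N)
    (hfin : ∫⁻ t in Set.Icc 0 T, N t < ⊤)
    (h : ∀ t ∈ Set.Icc 0 T, N t ≤ f t + ENNReal.ofReal c * ∫⁻ s in Set.Icc 0 t, N s) :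
    ∫⁻ t in Set.Icc 0 T, N t ≤
      ENNReal.ofReal (Real.exp (2 * c * T)) * (2 * ∫⁻ t in Set.Icc 0 T, f t) := by
  let e : ℝ → ENNReal := fun t => ENNReal.ofReal (Real.exp (-(2 * c) * t))
  have he : Measurable e := by fun_prop
  set X := ∫⁻ t in Set.Icc 0 T, e t * N t with hX
  have he1 : ∀ t ∈ Set.Icc 0 T, e t ≤ 1 := fun t ht => by
    rw [ENNReal.ofReal_le_one, Real.exp_le_one_iff]
    nlinarith [ht.1]
  have hXtop : X < ⊤ := lt_of_le_of_lt (setLIntegral_mono' measurableSet_Icc fun t ht =>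
    (mul_le_mul_left (he1 t ht) _).trans_eq (one_mul _)) hfin
  have hP : Measurable fun t => ∫⁻ s in Set.Icc 0 t, N s := by
    apply Monotone.measurable
    intro a b hab
    exact lintegral_mono_set (Set.Icc_subset_Icc_right hab)
  have hdouble : ∫⁻ t in Set.Icc 0 T, e t * ∫⁻ s in Set.Icc 0 t, N s ≤
      ENNReal.ofReal (1 / (2 * c)) * X := by
    have m1 : Measurable fun q : ℝ × ℝ => (Set.Ici q.2).indicator e q.1 * N q.2 := by
      have : Measurable fun q : ℝ × ℝ => (Set.Ici q.2).indicator e q.1 :=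
        Measurable.ite (p := fun q : ℝ × ℝ => q.1 ∈ Set.Ici q.2)
          (measurableSet_le measurable_snd measurable_fst)
          (he.comp measurable_fst) measurable_const
      fun_prop
    calc _ ≤ ∫⁻ t in Set.Icc 0 T, ∫⁻ s in Set.Icc 0 T, (Set.Ici s).indicator e t * N s := by
          refine setLIntegral_mono' measurableSet_Icc fun t ht => ?_
          rw [← lintegral_const_mul _ hN]
          refine le_trans (le_of_eq ?_) (lintegral_mono_set (Set.Icc_subset_Icc_right ht.2))
          refine setLIntegral_congr_fun measurableSet_Icc fun s hs => ?_
          rw [Set.indicator_of_mem (show t ∈ Set.Ici s from hs.2)]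
      _ = ∫⁻ s in Set.Icc 0 T, ∫⁻ t in Set.Icc 0 T, (Set.Ici s).indicator e t * N s :=
          lintegral_lintegral_swap m1.aemeasurable
      _ ≤ ∫⁻ s in Set.Icc 0 T, ENNReal.ofReal (1 / (2 * c)) * (e s * N s) := by
          refine lintegral_mono fun s => ?_
          simp only
          rw [lintegral_mul_const _ (he.indicator measurableSet_Ici), ← mul_assoc]
          refine mul_le_mul_left ?_ _
          calc _ ≤ ∫⁻ t, (Set.Ici s).indicator e t := setLIntegral_le_lintegral _ _
            _ = _ := by
              rw [lintegral_indicator measurableSet_Ici, lintegral_exp_neg_Ici (by linarith),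
                ← ENNReal.ofReal_mul (by positivity)]
              congr 1
              field_simp
      _ = _ := lintegral_const_mul _ (by fun_prop)
  have hXle : X ≤ (∫⁻ t in Set.Icc 0 T, f t) + ENNReal.ofReal (1 / 2) * X := by
    calc X ≤ ∫⁻ t in Set.Icc 0 T, (f t + ENNReal.ofReal c *
          (e t * ∫⁻ s in Set.Icc 0 t, N s)) := by
          refine setLIntegral_mono' measurableSet_Icc fun t ht => ?_
          refine (mul_le_mul_right (h t ht) _).trans ?_
          rw [mul_add]
          refine add_le_add ((mul_le_mul_left (he1 t ht) _).trans_eq (one_mul _)) (le_of_eq ?_)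
          ring
      _ ≤ _ := by
          rw [lintegral_add_right _ (by fun_prop), lintegral_const_mul _ (by fun_prop)]
          refine add_le_add_right ((mul_le_mul_right hdouble _).trans_eq ?_) _
          rw [← mul_assoc, ← ENNReal.ofReal_mul hc.le]
          congr 2
          field_simp
  have hX2 : X ≤ 2 * ∫⁻ t in Set.Icc 0 T, f t := by
    have h1 : X = ENNReal.ofReal (1 / 2) * X + ENNReal.ofReal (1 / 2) * X := by
      rw [← add_mul, ← ENNReal.ofReal_add (by norm_num) (by norm_num)]
      norm_num
    have hfinite : ENNReal.ofReal (1 / 2) * X ≠ ⊤ := by finiteness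
    have h2 : ENNReal.ofReal (1 / 2) * X ≤ ∫⁻ t in Set.Icc 0 T, f t := by
      exact (ENNReal.add_le_add_iff_right hfinite).1 (h1.symm.le.trans hXle)
    rw [h1, ← two_mul]
    exact mul_le_mul_right h2 _
  refine le_trans ?_ (mul_le_mul_right hX2 _)
  rw [hX, ← lintegral_const_mul _ (by fun_prop)]
  refine setLIntegral_mono' measurableSet_Icc fun t ht => ?_
  rw [← mul_assoc, ← ENNReal.ofReal_mul (Real.exp_pos _).le, ← Real.exp_add]
  refine (one_mul _).symm.le.trans (mul_le_mul_left ?_ _)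
  rw [ENNReal.one_le_ofReal, Real.one_le_exp_iff]
  nlinarith [ht.2]

/-- Regularity of a nonlinearity `f(x,u)` at a frozen time. -/
structure IsRegularNonlin (C : ℝ) (f : ℝ → ℝ → ℝ) : Prop where
  zero : ∀ x, f x 0 = 0
  diff : ∀ x, Differentiable ℝ (f x)
  diff_deriv : ∀ u, Differentiable ℝ fun x => deriv (f x) u
  deriv_le : ∀ x u, |deriv (f x) u| ≤ C
  deriv_deriv_le : ∀ x u, |deriv (fun x' => deriv (f x') u) x| ≤ C
  deriv_lip : ∀ x u₁ u₂, |deriv (f x) u₁ - deriv (f x) u₂| ≤ C * |u₁ - u₂|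

namespace IsRegularNonlin

variable {C : ℝ} {f : ℝ → ℝ → ℝ}

lemma nonneg (hf : IsRegularNonlin C f) : 0 ≤ C := (abs_nonneg _).trans (hf.deriv_le 0 0)

lemma deriv_sub_le (hf : IsRegularNonlin C f) (z' z u' u : ℝ) :
    |deriv (f z') u' - deriv (f z) u| ≤ C * |z' - z| + C * |u' - u| := by
  have h1 : |deriv (f z') u' - deriv (f z) u'| ≤ C * |z' - z| := by
    have := Convex.norm_image_sub_le_of_norm_deriv_le (f := fun x => deriv (f x) u')
      (s := Set.univ) (C := C) (fun x _ => (hf.diff_deriv u') x)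
      (fun x _ => hf.deriv_deriv_le x u') convex_univ (Set.mem_univ z) (Set.mem_univ z')
    simpa [Real.norm_eq_abs] using this
  have h2 := abs_sub_le (deriv (f z') u') (deriv (f z) u') (deriv (f z) u)
  linarith [hf.deriv_lip z u' u]

lemma abs_sub_le (hf : IsRegularNonlin C f) (z a b : ℝ) : |f z a - f z b| ≤ C * |a - b| := by
  have := Convex.norm_image_sub_le_of_norm_deriv_le (f := f z)
      (s := Set.univ) (C := C) (fun x _ => (hf.diff z) x)
      (fun x _ => hf.deriv_le z x) convex_univ (Set.mem_univ b) (Set.mem_univ a)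
  simpa [Real.norm_eq_abs] using this

lemma abs_second_diff_le (hf : IsRegularNonlin C f) (z' z a' a b' b : ℝ) :
    |(f z' a' - f z' b') - (f z a - f z b)| ≤
      C * |(a' - b') - (a - b)| +
        (C * |z' - z| + C * |a' - a| + C * |b' - b|) * |a - b| := by
  have hC := hf.nonneg
  let φ : ℝ → ℝ := fun θ => f z' (b' + θ * (a' - b')) - f z (b + θ * (a - b))
  have hd : ∀ θ, HasDerivAt φ (deriv (f z') (b' + θ * (a' - b')) * (a' - b') -
      deriv (f z) (b + θ * (a - b)) * (a - b)) θ := by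
    intro θ
    have aux : ∀ z a b : ℝ, HasDerivAt (fun θ => f z (b + θ * (a - b)))
        (deriv (f z) (b + θ * (a - b)) * (a - b)) θ := by
      intro z a b
      have h1 : HasDerivAt (fun θ : ℝ => b + θ * (a - b)) (a - b) θ := by
        simpa using ((hasDerivAt_id θ).mul_const (a - b)).const_add b
      exact ((hf.diff z) (b + θ * (a - b))).hasDerivAt.comp θ h1
    exact (aux z' a' b').sub (aux z a b)
  have hb : ∀ θ ∈ Set.Icc (0 : ℝ) 1, ‖deriv (f z') (b' + θ * (a' - b')) * (a' - b') -
      deriv (f z) (b + θ * (a - b)) * (a - b)‖ ≤ C * |(a' - b') - (a - b)| +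
        (C * |z' - z| + C * |a' - a| + C * |b' - b|) * |a - b| := by
    intro θ hθ
    rw [Real.norm_eq_abs]
    set p := deriv (f z') (b' + θ * (a' - b')) with hp
    set q := deriv (f z) (b + θ * (a - b)) with hq
    have e : p * (a' - b') - q * (a - b) = p * ((a' - b') - (a - b)) + (p - q) * (a - b) := by
      ring
    have h1 : |p - q| ≤ C * |z' - z| + C * |a' - a| + C * |b' - b| := by
      refine (hf.deriv_sub_le _ _ _ _).trans ?_
      have e2 : b' + θ * (a' - b') - (b + θ * (a - b)) =
          θ * (a' - a) + (1 - θ) * (b' - b) := by ring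
      have h2 : |b' + θ * (a' - b') - (b + θ * (a - b))| ≤ |a' - a| + |b' - b| := by
        rw [e2]
        refine (abs_add_le _ _).trans (add_le_add ?_ ?_)
        · rw [abs_mul, abs_of_nonneg hθ.1]
          exact mul_le_of_le_one_left (abs_nonneg _) hθ.2
        · rw [abs_mul, abs_of_nonneg (by linarith [hθ.2])]
          exact mul_le_of_le_one_left (abs_nonneg _) (by linarith [hθ.1])
      nlinarith
    rw [e]
    refine (abs_add_le _ _).trans ?_
    rw [abs_mul, abs_mul]
    exact add_le_add (mul_le_mul_of_nonneg_right (hf.deriv_le _ _) (abs_nonneg _))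
      (mul_le_mul_of_nonneg_right h1 (abs_nonneg _))
  have := Convex.norm_image_sub_le_of_norm_hasDerivWithin_le (f := φ) (s := Set.Icc (0 : ℝ) 1)
    (fun θ _ => (hd θ).hasDerivWithinAt) hb (convex_Icc 0 1)
    (Set.left_mem_Icc.2 zero_le_one) (Set.right_mem_Icc.2 zero_le_one)
  simp only [φ, Real.norm_eq_abs, sub_zero, abs_one, mul_one, one_mul, zero_mul,
    add_zero, add_sub_cancel] at this
  convert this using 2
  ring

lemma abs_diff_le (hf : IsRegularNonlin C f) (z' z a' a : ℝ) :
    |f z' a' - f z a| ≤ C * |a' - a| + C * |z' - z| * |a| := by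
  have h1 := hf.abs_sub_le z' a' a
  have h2 := hf.abs_second_diff_le z' z a a 0 0
  simp only [hf.zero, sub_zero, sub_self, abs_zero, mul_zero, add_zero, zero_add] at h2
  have h3 := _root_.abs_sub_le (f z' a') (f z' a) (f z a)
  linarith

lemma abs_second_diff_crude (hf : IsRegularNonlin C f) (z' z a' a b' b : ℝ) :
    |(f z' a' - f z' b') - (f z a - f z b)| ≤
      C * (|(a' - b') - (a - b)| + 2 * |b' - b| + |z' - z| * |a - b| + 2 * (|z' - z| * |b|)) := by
  have hC := hf.nonneg
  have h1 := hf.abs_diff_le z' z a' a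
  have h2 := hf.abs_diff_le z' z b' b
  have e : (f z' a' - f z' b') - (f z a - f z b) = (f z' a' - f z a) - (f z' b' - f z b) := by
    ring
  have h3 := abs_sub (f z' a' - f z a) (f z' b' - f z b)
  have h4 : |a' - a| ≤ |(a' - b') - (a - b)| + |b' - b| := by
    refine le_trans (le_of_eq ?_) (abs_add_le _ _)
    congr 1; ring
  have h5 : |a| ≤ |a - b| + |b| := by
    refine le_trans (le_of_eq ?_) (abs_add_le _ _)
    congr 1; ring
  have h6 := mul_le_mul_of_nonneg_left h4 hC
  have h7 := mul_le_mul_of_nonneg_left h5 (mul_nonneg hC (abs_nonneg (z' - z)))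
  rw [e]
  linarith

lemma abs_second_diff_fine (hf : IsRegularNonlin C f) (z' z a' a b' b : ℝ) :
    |(f z' a' - f z' b') - (f z a - f z b)| ≤
      C * (|(a' - b') - (a - b)| + |z' - z| * |a - b| + |(a' - b') - (a - b)| * |a - b| +
        2 * (|b' - b| * |a - b|)) := by
  have hC := hf.nonneg
  have h1 := hf.abs_second_diff_le z' z a' a b' b
  have h4 : |a' - a| ≤ |(a' - b') - (a - b)| + |b' - b| := by
    refine le_trans (le_of_eq ?_) (abs_add_le _ _)
    congr 1; ring
  have h6 := mul_le_mul_of_nonneg_right (mul_le_mul_of_nonneg_left h4 hC) (abs_nonneg (a - b))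
  linarith

end IsRegularNonlin

lemma ofReal_sq_le_of_abs_le_sum {C x a b c d : ℝ} (h : |x| ≤ C * (|a| + |b| + |c| + |d|)) :
    ENNReal.ofReal (x ^ 2) ≤ ENNReal.ofReal (4 * C ^ 2) * (ENNReal.ofReal (a ^ 2) +
      ENNReal.ofReal (b ^ 2) + ENNReal.ofReal (c ^ 2) + ENNReal.ofReal (d ^ 2)) := by
  rw [← ENNReal.ofReal_add (by positivity) (by positivity),
    ← ENNReal.ofReal_add (by positivity) (by positivity),
    ← ENNReal.ofReal_add (by positivity) (by positivity), ← ENNReal.ofReal_mul (by positivity)]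
  apply ENNReal.ofReal_le_ofReal
  rw [← sq_abs x, ← sq_abs a, ← sq_abs b, ← sq_abs c, ← sq_abs d]
  have h1 : |x| ^ 2 ≤ (C * (|a| + |b| + |c| + |d|)) ^ 2 := pow_le_pow_left₀ (abs_nonneg x) h 2
  rw [mul_pow] at h1
  have h2 : (|a| + |b| + |c| + |d|) ^ 2 ≤ 4 * (|a| ^ 2 + |b| ^ 2 + |c| ^ 2 + |d| ^ 2) := by
    nlinarith [sq_nonneg (|a| - |b|), sq_nonneg (|a| - |c|), sq_nonneg (|a| - |d|),
      sq_nonneg (|b| - |c|), sq_nonneg (|b| - |d|), sq_nonneg (|c| - |d|)]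
  nlinarith [mul_le_mul_of_nonneg_left h2 (sq_nonneg C)]

/-- A bound for the energy of the identity on `[-r, r]`, `r ≤ R`. -/
noncomputable def idEnergy (H R : ℝ) : ENNReal :=
  ENNReal.ofReal (2 * R) * ENNReal.ofReal (4 * R * (1 + 2 * R)) * wgtConst H

lemma idEnergy_ne_top {H : ℝ} (hH : H ∈ Set.Ioo (1 / 4 : ℝ) (1 / 2 : ℝ)) (R : ℝ) :
    idEnergy H R ≠ ⊤ := by
  have := (wgtConst_lt_top hH).ne
  unfold idEnergy
  finiteness

lemma lintegral_bothIn_sq_le {H r R : ℝ} (hr : r ≤ R) (hR : 0 ≤ R) :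
    ∫⁻ h, ∫⁻ z, bothIn r z h * ENNReal.ofReal (h ^ 2) * wgt H h ≤ idEnergy H R := by
  have hm : Measurable fun h : ℝ => ENNReal.ofReal (√(min |h| 1)) * wgt H h := by
    have := measurable_wgt H
    fun_prop
  unfold idEnergy wgtConst
  rw [← lintegral_const_mul _ hm]
  refine lintegral_mono fun h => ?_
  simp only
  rw [lintegral_mul_const' _ _ (by simp [wgt]), lintegral_mul_const' _ _ (by simp), ← mul_assoc]
  refine mul_le_mul_left ?_ _
  rcases lt_or_ge (2 * R) |h| with hh | hh
  · have : ∀ x, bothIn r x h = 0 := fun x => bothIn_eq_zero (by linarith)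
    simp [this]
  · rw [mul_assoc (ENNReal.ofReal (2 * R)), ← ENNReal.ofReal_mul (by positivity)]
    refine mul_le_mul' ((lintegral_bothIn_le _ _).trans (ENNReal.ofReal_le_ofReal (by linarith)))
      (ENNReal.ofReal_le_ofReal ?_)
    have h1 := sqrt_add_le_mul_sqrt_min hh
    have h2 := Real.sqrt_nonneg (2 * |h|)
    rw [← sq_abs]
    nlinarith [abs_nonneg h]

lemma enSq_le_of_increments {H r R : ℝ} (hr : r ≤ R) (hR : 0 ≤ R) {D w b : ℝ → ℝ}
    (hw : Measurable w) (hb : Measurable b) {k₁ k₂ k₃ : ENNReal}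
    (h : ∀ z h, |z| ≤ r → |z + h| ≤ r → ENNReal.ofReal ((D (z + h) - D z) ^ 2) ≤
      k₁ * ENNReal.ofReal ((w (z + h) - w z) ^ 2) + k₂ * ENNReal.ofReal ((b (z + h) - b z) ^ 2) +
      k₃ * ENNReal.ofReal (h ^ 2)) :
    enSq H r D ≤ k₁ * enSq H r w + k₂ * enSq H r b + k₃ * idEnergy H R := by
  have h2 : Measurable fun p : ℝ × ℝ => bothIn r p.1 p.2 :=
    measurable_bothIn_comp measurable_const measurable_fst measurable_snd
  have h3 : Measurable fun p : ℝ × ℝ => wgt H p.2 := (measurable_wgt H).comp measurable_snd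
  have key : ∀ (k : ENNReal) (F : ℝ × ℝ → ℝ), Measurable F →
      ∫⁻ h : ℝ, ∫⁻ z : ℝ, k * (bothIn r z h * ENNReal.ofReal (F (z, h) ^ 2) * wgt H h) =
      k * ∫⁻ h : ℝ, ∫⁻ z : ℝ, bothIn r z h * ENNReal.ofReal (F (z, h) ^ 2) * wgt H h := by
    intro k F hF
    have m : Measurable fun p : ℝ × ℝ => bothIn r p.1 p.2 * ENNReal.ofReal (F p ^ 2) *
      wgt H p.2 := by fun_prop
    rw [← lintegral_const_mul _ m.lintegral_prod_left']
    exact lintegral_congr fun h =>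
      lintegral_const_mul _ (m.comp (measurable_id.prodMk measurable_const))
  have mw : Measurable fun p : ℝ × ℝ => w (p.1 + p.2) - w p.1 := by fun_prop
  have mb : Measurable fun p : ℝ × ℝ => b (p.1 + p.2) - b p.1 := by fun_prop
  have mi : Measurable fun p : ℝ × ℝ => p.2 := measurable_snd
  have e1 := key k₁ _ mw
  have e2 := key k₂ _ mb
  have e3 := key k₃ _ mi
  simp only at e1 e2 e3
  calc enSq H r D ≤ ∫⁻ h : ℝ, ∫⁻ z : ℝ,
        ((k₁ * (bothIn r z h * ENNReal.ofReal ((w (z + h) - w z) ^ 2) * wgt H h) +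
        k₂ * (bothIn r z h * ENNReal.ofReal ((b (z + h) - b z) ^ 2) * wgt H h)) +
        k₃ * (bothIn r z h * ENNReal.ofReal (h ^ 2) * wgt H h)) := by
        refine lintegral_mono fun y => lintegral_mono fun z => ?_
        by_cases hz : |z| ≤ r ∧ |z + y| ≤ r
        · simp only [bothIn, hz, and_self, if_true, one_mul]
          refine (mul_le_mul_left (h z y hz.1 hz.2) _).trans_eq ?_
          ring
        · simp only [bothIn, hz, if_false, zero_mul]
          exact zero_le
    _ = k₁ * enSq H r w + k₂ * enSq H r b +
        k₃ * ∫⁻ h : ℝ, ∫⁻ z : ℝ, bothIn r z h * ENNReal.ofReal (h ^ 2) * wgt H h := by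
        rw [lintegral_lintegral_add (f := fun p => k₁ * (bothIn r p.1 p.2 *
            ENNReal.ofReal ((w (p.1 + p.2) - w p.1) ^ 2) * wgt H p.2) + k₂ * (bothIn r p.1 p.2 *
            ENNReal.ofReal ((b (p.1 + p.2) - b p.1) ^ 2) * wgt H p.2))
            (g := fun p => k₃ * (bothIn r p.1 p.2 * ENNReal.ofReal (p.2 ^ 2) * wgt H p.2))
            (by fun_prop),
          lintegral_lintegral_add (f := fun p => k₁ * (bothIn r p.1 p.2 *
            ENNReal.ofReal ((w (p.1 + p.2) - w p.1) ^ 2) * wgt H p.2))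
            (g := fun p => k₂ * (bothIn r p.1 p.2 *
            ENNReal.ofReal ((b (p.1 + p.2) - b p.1) ^ 2) * wgt H p.2)) (by fun_prop), e1, e2, e3]
        rfl
    _ ≤ _ := add_le_add_right (mul_le_mul_right (lintegral_bothIn_sq_le hr hR) _) _

lemma ofReal_mul_sq (x y : ℝ) :
    ENNReal.ofReal ((x * y) ^ 2) = ENNReal.ofReal (x ^ 2) * ENNReal.ofReal (y ^ 2) := by
  rw [mul_pow, ENNReal.ofReal_mul (sq_nonneg _)]

lemma supSq_nonlin_sub_le {R C s : ℝ} {f : ℝ → ℝ → ℝ → ℝ} (hf : ∀ s, IsRegularNonlin C (f s))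
    (hs : s < R) {a b : ℝ → ℝ → ℝ} :
    supSq R (fun s z => f s z (a s z) - f s z (b s z)) s ≤
      ENNReal.ofReal (4 * C ^ 2) * supSq R (fun s z => a s z - b s z) s := by
  refine supSq_le hs.le fun z hz => ?_
  refine le_trans ?_ (mul_le_mul_right (le_supSq (fun s z => a s z - b s z) hs hz) _)
  rw [← ENNReal.ofReal_mul (by positivity)]
  apply ENNReal.ofReal_le_ofReal
  have := pow_le_pow_left₀ (abs_nonneg _) ((hf s).abs_sub_le z (a s z) (b s z)) 2
  rw [sq_abs, mul_pow, sq_abs] at this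
  nlinarith [mul_nonneg (sq_nonneg C) (sq_nonneg (a s z - b s z))]

lemma coneNorm_nonlin_sub_le {H R C s : ℝ} {f : ℝ → ℝ → ℝ → ℝ} (hf : ∀ s, IsRegularNonlin C (f s))
    (hs : s ∈ Set.Ico 0 R) {a b : ℝ → ℝ → ℝ} (ha : Measurable fun q : ℝ × ℝ => a q.1 q.2)
    (hb : Measurable fun q : ℝ × ℝ => b q.1 q.2) :
    coneNorm H R (fun s z => f s z (a s z) - f s z (b s z)) s ≤
      ENNReal.ofReal (4 * C ^ 2) * (4 + 4 * idEnergy H R) *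
        (coneNorm H R (fun s z => a s z - b s z) s + coneNorm H R b s) := by
  set k := ENNReal.ofReal (4 * C ^ 2) with hk
  set w : ℝ → ℝ → ℝ := fun s z => a s z - b s z with hw
  have has : Measurable (a s) := ha.comp measurable_prodMk_left
  have hbs : Measurable (b s) := hb.comp measurable_prodMk_left
  have h1 : supSq R (fun s z => f s z (a s z) - f s z (b s z)) s ≤ k * supSq R w s :=
    supSq_nonlin_sub_le hf hs.2
  have h2 : enSq H (R - s) (fun z => f s z (a s z) - f s z (b s z)) ≤
      k * enSq H (R - s) (w s) + 4 * k * enSq H (R - s) (b s) +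
        k * (supSq R w s + 4 * supSq R b s) * idEnergy H R := by
    refine enSq_le_of_increments (by linarith [hs.1]) (hs.1.trans hs.2.le)
      (show Measurable (w s) from has.sub hbs) hbs ?_
    intro z h hz hzh
    have h3 := (hf s).abs_second_diff_crude (z + h) z (a s (z + h)) (a s z) (b s (z + h)) (b s z)
    rw [add_sub_cancel_left] at h3
    have h4 := ofReal_sq_le_of_abs_le_sum (C := C) (a := w s (z + h) - w s z)
      (b := 2 * (b s (z + h) - b s z)) (c := h * w s z) (d := 2 * (h * b s z))
      (x := (f s (z + h) (a s (z + h)) - f s (z + h) (b s (z + h))) -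
        (f s z (a s z) - f s z (b s z))) (h3.trans_eq (by
          simp only [hw, abs_mul, abs_two]))
    refine h4.trans ?_
    have e4 : ENNReal.ofReal (2 ^ 2) = 4 := by norm_num
    simp only [ofReal_mul_sq, e4, ← hk]
    calc _ ≤ k * (ENNReal.ofReal ((w s (z + h) - w s z) ^ 2) +
          4 * ENNReal.ofReal ((b s (z + h) - b s z) ^ 2) +
          ENNReal.ofReal (h ^ 2) * supSq R w s +
          4 * (ENNReal.ofReal (h ^ 2) * supSq R b s)) := by
          gcongr
          · exact le_supSq w hs.2 hz
          · exact le_supSq b hs.2 hz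
      _ = _ := by ring
  set I := idEnergy H R
  unfold coneNorm
  refine (add_le_add h1 h2).trans ?_
  set p := supSq R w s
  set q := supSq R b s
  set e := enSq H (R - s) (w s)
  set e' := enSq H (R - s) (b s)
  have : k * (4 + 4 * I) * (p + e + (q + e')) =
      (k * p + (k * e + 4 * k * e' + k * (p + 4 * q) * I)) +
      k * (3 * p + 4 * q + 3 * e + I * (3 * p) + I * (4 * e + 4 * e')) := by ring
  exact this ▸ le_self_add

lemma coneNorm_nonlin_sub_le_mul {H R C s : ℝ} {f : ℝ → ℝ → ℝ → ℝ}
    (hf : ∀ s, IsRegularNonlin C (f s))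
    (hs : s ∈ Set.Ico 0 R) {a b : ℝ → ℝ → ℝ} (ha : Measurable fun q : ℝ × ℝ => a q.1 q.2)
    (hb : Measurable fun q : ℝ × ℝ => b q.1 q.2) {M E : ENNReal}
    (hM : supSq R (fun s z => a s z - b s z) s ≤ M) (hE : enSq H (R - s) (b s) ≤ E) :
    coneNorm H R (fun s z => f s z (a s z) - f s z (b s z)) s ≤
      ENNReal.ofReal (4 * C ^ 2) * (1 + M + 4 * E + idEnergy H R) *
        coneNorm H R (fun s z => a s z - b s z) s := by
  set k := ENNReal.ofReal (4 * C ^ 2) with hk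
  set w : ℝ → ℝ → ℝ := fun s z => a s z - b s z with hw
  have has : Measurable (a s) := ha.comp measurable_prodMk_left
  have hbs : Measurable (b s) := hb.comp measurable_prodMk_left
  have h1 : supSq R (fun s z => f s z (a s z) - f s z (b s z)) s ≤ k * supSq R w s :=
    supSq_nonlin_sub_le hf hs.2
  have h2 : enSq H (R - s) (fun z => f s z (a s z) - f s z (b s z)) ≤
      k * (1 + M) * enSq H (R - s) (w s) + 4 * k * supSq R w s * enSq H (R - s) (b s) +
        k * supSq R w s * idEnergy H R := by
    refine enSq_le_of_increments (by linarith [hs.1]) (hs.1.trans hs.2.le)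
      (show Measurable (w s) from has.sub hbs) hbs ?_
    intro z h hz hzh
    have h3 := (hf s).abs_second_diff_fine (z + h) z (a s (z + h)) (a s z) (b s (z + h)) (b s z)
    rw [add_sub_cancel_left] at h3
    have h4 := ofReal_sq_le_of_abs_le_sum (C := C) (a := w s (z + h) - w s z)
      (b := h * w s z) (c := (w s (z + h) - w s z) * w s z)
      (d := 2 * ((b s (z + h) - b s z) * w s z))
      (x := (f s (z + h) (a s (z + h)) - f s (z + h) (b s (z + h))) -
        (f s z (a s z) - f s z (b s z))) (h3.trans_eq (by
          simp only [hw, abs_mul, abs_two]))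
    refine h4.trans ?_
    have e4 : ENNReal.ofReal (2 ^ 2) = 4 := by norm_num
    have hp := le_supSq w hs.2 hz
    simp only [ofReal_mul_sq, e4, ← hk]
    calc _ ≤ k * (ENNReal.ofReal ((w s (z + h) - w s z) ^ 2) +
          ENNReal.ofReal (h ^ 2) * supSq R w s +
          ENNReal.ofReal ((w s (z + h) - w s z) ^ 2) * M +
          4 * (ENNReal.ofReal ((b s (z + h) - b s z) ^ 2) * supSq R w s)) := by
          gcongr
          exact hp.trans hM
      _ = _ := by ring
  set I := idEnergy H R
  unfold coneNorm
  refine (add_le_add h1 (h2.trans (add_le_add_left (add_le_add_right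
    (mul_le_mul_right hE _) _) _))).trans ?_
  set p := supSq R w s
  set e := enSq H (R - s) (w s)
  have : k * (1 + M + 4 * E + I) * (p + e) =
      (k * p + (k * (1 + M) * e + 4 * k * p * E + k * p * I)) +
      k * (M * p + 4 * E * e + I * e) := by ring
  exact this ▸ le_self_add

/-- The linear Duhamel term `⟨G(t-·,x-·) D, k⟩` in `L²([0,T]; 𝓗)`. -/
noncomputable def duhamel (H T : ℝ) (D k : ℝ → ℝ → ℝ) (p : ℝ × ℝ) : ℝ :=
  pathInner H T (mild D p.1 p.2) k

lemma pathNormSq_mild_lt_top {H R T : ℝ} (hH : H ∈ Set.Ioo (1 / 4 : ℝ) (1 / 2 : ℝ))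
    (hR : T < R) {D : ℝ → ℝ → ℝ} (hD : Continuous fun q : ℝ × ℝ => D q.1 q.2)
    (hDT : ∫⁻ s in Set.Icc (0 : ℝ) T, coneNorm H R D s < ⊤) {p : ℝ × ℝ} (hp : p ∈ cone R T) :
    pathNormSq H T (mild D p.1 p.2) < ⊤ := by
  obtain ⟨K, hK, h⟩ := exists_pathNormSq_mild_le hH hR
  have h2 : ∫⁻ s in Set.Icc (0 : ℝ) p.1, coneNorm H R D s < ⊤ :=
    (lintegral_coneNorm_mono hp.1 D).trans_lt hDT
  exact (h D hD p.1 hp.1 p.2 hp.2).trans_lt (by finiteness)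

lemma duhamel_sub_sq_le {H R T : ℝ} (hH : H ∈ Set.Ioo (1 / 4 : ℝ) (1 / 2 : ℝ))
    (hR : T < R) {D : ℝ → ℝ → ℝ} (hD : Continuous fun q : ℝ × ℝ => D q.1 q.2)
    (hDT : ∫⁻ s in Set.Icc (0 : ℝ) T, coneNorm H R D s < ⊤) {k : ℝ → ℝ → ℝ}
    (hk : Measurable fun q : ℝ × ℝ => k q.1 q.2) {M : ENNReal} (hM : M ≠ ⊤)
    (hkM : pathNormSq H T k ≤ M) {p p₀ : ℝ × ℝ} (hp : p ∈ cone R T) (hp₀ : p₀ ∈ cone R T) :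
    ENNReal.ofReal ((duhamel H T D k p - duhamel H T D k p₀) ^ 2) ≤
      pathNormSq H T (fun s z => mild D p.1 p.2 s z - mild D p₀.1 p₀.2 s z) * M := by
  have f1 := pathNormSq_mild_lt_top hH hR hD hDT hp
  have f2 := pathNormSq_mild_lt_top hH hR hD hDT hp₀
  have hm := fun p : ℝ × ℝ => measurable_mild hD.measurable p.1 p.2
  have hkT := hkM.trans_lt hM.lt_top
  unfold duhamel
  rw [← pathInner_sub_left hH (memLp_wIncr hH (hm _) f1)
    (memLp_wIncr hH (hm _) f2) (memLp_wIncr hH hk hkT)]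
  refine (pathInner_sq_le hH ((hm p).sub (hm p₀)) hk ?_ hkT).trans (mul_le_mul_right hkM _)
  exact (pathNormSq_sub_le hH (hm p) (hm p₀)).trans_lt (by finiteness)

lemma tendsto_zero_of_ofReal_sq {ι : Type*} {l : Filter ι} {f : ι → ℝ}
    (h : Filter.Tendsto (fun i => ENNReal.ofReal (f i ^ 2)) l (nhds 0)) :
    Filter.Tendsto f l (nhds 0) := by
  have h1 := (ENNReal.tendsto_toReal ENNReal.zero_ne_top).comp h
  have h2 := (Real.continuous_sqrt.tendsto _).comp h1
  rw [tendsto_zero_iff_abs_tendsto_zero]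
  simp only [ENNReal.toReal_zero, Real.sqrt_zero] at h2
  refine h2.congr fun i => ?_
  simp only [Function.comp_apply]
  rw [ENNReal.toReal_ofReal (sq_nonneg _), Real.sqrt_sq_eq_abs]

lemma continuousOn_duhamel {H R T : ℝ} (hH : H ∈ Set.Ioo (1 / 4 : ℝ) (1 / 2 : ℝ))
    (hR : T < R) {D : ℝ → ℝ → ℝ} (hD : Continuous fun q : ℝ × ℝ => D q.1 q.2)
    (hDT : ∫⁻ s in Set.Icc (0 : ℝ) T, coneNorm H R D s < ⊤) {k : ℝ → ℝ → ℝ}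
    (hk : Measurable fun q : ℝ × ℝ => k q.1 q.2) (hkT : pathNormSq H T k < ⊤) :
    ContinuousOn (duhamel H T D k) (cone R T) := by
  intro p₀ hp₀
  have h1 : Filter.Tendsto (fun p => pathNormSq H T (fun s z => mild D p.1 p.2 s z -
      mild D p₀.1 p₀.2 s z) * pathNormSq H T k) (nhdsWithin p₀ (cone R T)) (nhds 0) := by
    simpa using ENNReal.Tendsto.mul_const (tendsto_pathNormSq_mild_sub hH hR hD hDT hp₀)
      (Or.inr hkT.ne)
  have h2 : Filter.Tendsto (fun p => ENNReal.ofReal ((duhamel H T D k p -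
      duhamel H T D k p₀) ^ 2)) (nhdsWithin p₀ (cone R T)) (nhds 0) := by
    refine tendsto_of_tendsto_of_tendsto_of_le_of_le' tendsto_const_nhds h1
      (Filter.Eventually.of_forall fun _ => zero_le) ?_
    filter_upwards [self_mem_nhdsWithin] with p hp
    exact duhamel_sub_sq_le hH hR hD hDT hk hkT.ne le_rfl hp hp₀
  exact tendsto_sub_nhds_zero_iff.1 (tendsto_zero_of_ofReal_sq h2)

lemma eventually_duhamel_sq_le {H R T : ℝ} (hH : H ∈ Set.Ioo (1 / 4 : ℝ) (1 / 2 : ℝ))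
    (hR : T < R) {D : ℝ → ℝ → ℝ} (hD : Continuous fun q : ℝ × ℝ => D q.1 q.2)
    (hDT : ∫⁻ s in Set.Icc (0 : ℝ) T, coneNorm H R D s < ⊤) {k : ℕ → ℝ → ℝ → ℝ}
    (hk : ∀ n, Measurable fun q : ℝ × ℝ => k n q.1 q.2) {M : ENNReal} (hM : M ≠ ⊤)
    (hkM : ∀ n, pathNormSq H T (k n) ≤ M)
    (hlim : ∀ p ∈ cone R T, Filter.Tendsto (fun n => duhamel H T D (k n) p) Filter.atTop (nhds 0))
    {ε : ENNReal} (hε : 0 < ε) :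
    ∀ᶠ n in Filter.atTop, ∀ p ∈ cone R T, ENNReal.ofReal (duhamel H T D (k n) p ^ 2) ≤ ε := by
  refine (isCompact_cone R T).induction_on (p := fun s => ∀ᶠ n in Filter.atTop, ∀ p ∈ s,
    ENNReal.ofReal (duhamel H T D (k n) p ^ 2) ≤ ε) (by simp) ?_ ?_ ?_
  · intro s t hst h
    filter_upwards [h] with n hn p hp using hn p (hst hp)
  · intro s t h1 h2
    filter_upwards [h1, h2] with n hn1 hn2 p hp
    exact hp.elim (hn1 p) (hn2 p)
  · intro p₀ hp₀
    have h1 : Filter.Tendsto (fun p => 2 * (pathNormSq H T (fun s z => mild D p.1 p.2 s z -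
        mild D p₀.1 p₀.2 s z) * M)) (nhdsWithin p₀ (cone R T)) (nhds 0) := by
      simpa using ENNReal.Tendsto.const_mul (a := 2) (ENNReal.Tendsto.mul_const
        (tendsto_pathNormSq_mild_sub hH hR hD hDT hp₀) (Or.inr hM)) (Or.inr (by simp))
    have h2 : Filter.Tendsto (fun n => 2 * ENNReal.ofReal (duhamel H T D (k n) p₀ ^ 2))
        Filter.atTop (nhds 0) := by
      have := ENNReal.Tendsto.const_mul (a := 2)
        ((ENNReal.continuous_ofReal.tendsto _).comp ((hlim p₀ hp₀).pow 2)) (Or.inr (by simp))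
      simpa using this
    have hε2 : 0 < ε / 2 := ENNReal.half_pos hε.ne'
    refine ⟨{p | p ∈ cone R T ∧ 2 * (pathNormSq H T (fun s z => mild D p.1 p.2 s z -
        mild D p₀.1 p₀.2 s z) * M) ≤ ε / 2}, ?_, ?_⟩
    · filter_upwards [self_mem_nhdsWithin, (ENNReal.tendsto_nhds_zero.1 h1) _ hε2] with p hp hp'
      exact ⟨hp, hp'⟩
    · filter_upwards [(ENNReal.tendsto_nhds_zero.1 h2) _ hε2] with n hn p hp
      have e : duhamel H T D (k n) p = (duhamel H T D (k n) p - duhamel H T D (k n) p₀) +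
        duhamel H T D (k n) p₀ := by ring
      rw [e]
      refine (ofReal_sq_add_le _ _).trans ?_
      rw [← ENNReal.add_halves ε]
      refine add_le_add (le_trans (mul_le_mul_right
        (duhamel_sub_sq_le hH hR hD hDT (hk n) hM (hkM n) hp.1 hp₀) _) hp.2) hn

lemma tendsto_lintegral_enSq_duhamel {H R T : ℝ} (hH : H ∈ Set.Ioo (1 / 4 : ℝ) (1 / 2 : ℝ))
    (hR : T < R) {D : ℝ → ℝ → ℝ} (hD : Continuous fun q : ℝ × ℝ => D q.1 q.2)
    (hDT : ∫⁻ s in Set.Icc (0 : ℝ) T, coneNorm H R D s < ⊤) {k : ℕ → ℝ → ℝ → ℝ}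
    (hk : ∀ n, Measurable fun q : ℝ × ℝ => k n q.1 q.2) {M : ENNReal} (hM : M ≠ ⊤)
    (hkM : ∀ n, pathNormSq H T (k n) ≤ M)
    (hlim : ∀ p ∈ cone R T, Filter.Tendsto (fun n => duhamel H T D (k n) p) Filter.atTop (nhds 0))
    {r : ℕ → ℝ → ℝ → ℝ} (hr : ∀ n, Measurable fun q : ℝ × ℝ => r n q.1 q.2)
    (hrk : ∀ n, ∀ p ∈ cone R T, r n p.1 p.2 = duhamel H T D (k n) p) :
    Filter.Tendsto (fun n => ∫⁻ t in Set.Icc (0 : ℝ) T, enSq H (R - t) (r n t))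
      Filter.atTop (nhds 0) := by
  let μ : Measure (ℝ × ℝ × ℝ) := (volume.restrict (Set.Icc (0 : ℝ) T)).prod volume
  let F : ℕ → ℝ × ℝ × ℝ → ENNReal := fun n q =>
    bothIn (R - q.1) q.2.2 q.2.1 *
      ENNReal.ofReal ((r n q.1 (q.2.2 + q.2.1) - r n q.1 q.2.2) ^ 2) * wgt H q.2.1
  let B : ℝ × ℝ × ℝ → ENNReal := fun q => M * (bothIn (R - q.1) q.2.2 q.2.1 * pathNormSq H T
    (fun s z => mild D q.1 (q.2.2 + q.2.1) s z - mild D q.1 q.2.2 s z) * wgt H q.2.1)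
  have hF : ∀ n, Measurable (F n) := by
    intro n
    have h1 : Measurable fun q : ℝ × ℝ × ℝ => bothIn (R - q.1) q.2.2 q.2.1 :=
      measurable_bothIn_comp (by fun_prop) (by fun_prop) (by fun_prop)
    have h2 : Measurable fun q : ℝ × ℝ × ℝ => wgt H q.2.1 :=
      (measurable_wgt H).comp (by fun_prop)
    have h3 : Measurable fun q : ℝ × ℝ × ℝ => r n q.1 (q.2.2 + q.2.1) :=
      (hr n).comp (f := fun q : ℝ × ℝ × ℝ => (q.1, q.2.2 + q.2.1)) (by fun_prop)
    have h4 : Measurable fun q : ℝ × ℝ × ℝ => r n q.1 q.2.2 :=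
      (hr n).comp (f := fun q : ℝ × ℝ × ℝ => (q.1, q.2.2)) (by fun_prop)
    fun_prop
  have hstrip : ∀ᵐ q ∂μ, q.1 ∈ Set.Icc (0 : ℝ) T :=
    Measure.quasiMeasurePreserving_fst.ae (ae_restrict_mem measurableSet_Icc)
  have heq : ∀ n, ∫⁻ t in Set.Icc (0 : ℝ) T, enSq H (R - t) (r n t) = ∫⁻ q, F n q ∂μ := by
    intro n
    rw [lintegral_prod _ (hF n).aemeasurable]
    refine lintegral_congr fun t => ?_
    rw [Measure.volume_eq_prod]
    exact (lintegral_prod (fun y => F n (t, y))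
      ((hF n).comp measurable_prodMk_left).aemeasurable).symm
  have hBfin : ∫⁻ q, B q ∂μ ≠ ⊤ := by
    obtain ⟨K, hK, h⟩ := exists_enSq_pathNormSq_mild_le hH hR
    set A := ∫⁻ s in Set.Icc (0 : ℝ) T, coneNorm H R D s
    have hA : M * (K * A) ≠ ⊤ := by finiteness
    refine ne_top_of_le_ne_top (b := ∫⁻ _ in Set.Icc (0 : ℝ) T, M * (K * A)) ?_ ?_
    · rw [lintegral_const, Measure.restrict_apply_univ, Real.volume_Icc]
      finiteness
    · refine (lintegral_prod_le B).trans (setLIntegral_mono' measurableSet_Icc fun t ht => ?_)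
      rw [Measure.volume_eq_prod]
      refine (lintegral_prod_le fun y => B (t, y)).trans ?_
      simp only [B]
      simp_rw [lintegral_const_mul' _ _ hM]
      exact mul_le_mul_right ((h D hD t ht).trans
        (mul_le_mul_right (lintegral_coneNorm_mono ht D) _)) _
  have hmain : Filter.Tendsto (fun n => ∫⁻ q, F n q ∂μ) Filter.atTop (nhds (∫⁻ _, 0 ∂μ)) := by
    refine tendsto_lintegral_of_dominated_convergence B hF ?_ hBfin ?_
    · intro n
      filter_upwards [hstrip] with q hq
      by_cases hx : |q.2.2| ≤ R - q.1 ∧ |q.2.2 + q.2.1| ≤ R - q.1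
      · simp only [F, B]
        rw [← mul_assoc, mul_left_comm M]
        refine mul_le_mul_left (mul_le_mul_right ?_ _) _
        rw [hrk n (q.1, q.2.2 + q.2.1) ⟨hq, hx.2⟩, hrk n (q.1, q.2.2) ⟨hq, hx.1⟩, mul_comm M]
        exact duhamel_sub_sq_le hH hR hD hDT (hk n) hM (hkM n) ⟨hq, hx.2⟩ ⟨hq, hx.1⟩
      · simp only [F, bothIn, hx, if_false, zero_mul]
        exact zero_le
    · filter_upwards [hstrip] with q hq
      by_cases hx : |q.2.2| ≤ R - q.1 ∧ |q.2.2 + q.2.1| ≤ R - q.1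
      · have h1 : Filter.Tendsto (fun n => r n q.1 (q.2.2 + q.2.1)) Filter.atTop (nhds 0) :=
          (hlim (q.1, q.2.2 + q.2.1) ⟨hq, hx.2⟩).congr fun n => (hrk n _ ⟨hq, hx.2⟩).symm
        have h2 : Filter.Tendsto (fun n => r n q.1 q.2.2) Filter.atTop (nhds 0) :=
          (hlim (q.1, q.2.2) ⟨hq, hx.1⟩).congr fun n => (hrk n _ ⟨hq, hx.1⟩).symm
        have h3 := (ENNReal.continuous_ofReal.tendsto _).comp ((h1.sub h2).pow 2)
        have h4 := ENNReal.Tendsto.mul_const (b := wgt H q.2.1) (ENNReal.Tendsto.const_mul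
          (a := bothIn (R - q.1) q.2.2 q.2.1) h3
          (Or.inr ((bothIn_le_one _ _ _).trans_lt ENNReal.one_lt_top).ne))
          (Or.inr (by simp [wgt]))
        simpa [F, Function.comp_def] using h4
      · simp only [F, bothIn, hx, if_false, zero_mul]
        exact tendsto_const_nhds
  simpa [heq] using hmain

lemma exists_lintegral_le_of_gronwall (T : ℝ) {c : ENNReal} (hc : c ≠ ⊤) :
    ∃ L : ENNReal, L ≠ ⊤ ∧ ∀ N f : ℝ → ENNReal, Measurable N → ∫⁻ t in Set.Icc 0 T, N t < ⊤ →
      (∀ t ∈ Set.Icc 0 T, N t ≤ f t + c * ∫⁻ s in Set.Icc 0 t, N s) →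
      ∫⁻ t in Set.Icc 0 T, N t ≤ L * ∫⁻ t in Set.Icc 0 T, f t := by
  have hc0 := ENNReal.toReal_nonneg (a := c)
  refine ⟨ENNReal.ofReal (Real.exp (2 * (c.toReal + 1) * T)) * 2, by finiteness, ?_⟩
  intro N f hN hfin h
  rw [mul_assoc]
  refine lintegral_le_of_gronwall (by linarith) hN hfin fun t ht => (h t ht).trans ?_
  refine add_le_add_right (mul_le_mul_left ?_ _) _
  exact (ENNReal.ofReal_toReal hc).symm.le.trans (ENNReal.ofReal_le_ofReal (by linarith))

lemma enSq_mono_of_eqOn {H r : ℝ} {φ ψ : ℝ → ℝ} (h : ∀ z, |z| ≤ r → φ z = ψ z) :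
    enSq H r φ ≤ enSq H r ψ := by
  refine lintegral_mono fun y => lintegral_mono fun z => ?_
  by_cases hz : |z| ≤ r ∧ |z + y| ≤ r
  · rw [h _ hz.1, h _ hz.2]
  · simp [bothIn, hz]

lemma coneNorm_mono_of_eqOn {H R s : ℝ} {v w : ℝ → ℝ → ℝ} (hs : s < R)
    (h : ∀ z, |z| ≤ R - s → v s z = w s z) : coneNorm H R v s ≤ coneNorm H R w s :=
  add_le_add (supSq_le hs.le fun z hz => by rw [h z hz]; exact le_supSq w hs hz)
    (enSq_mono_of_eqOn h)

lemma coneNorm_le_of_eq_add {H R s : ℝ} {w v r : ℝ → ℝ → ℝ} (hs : s ∈ Set.Ico 0 R)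
    (hw : Measurable (w s)) (hr : Measurable (r s))
    (h : ∀ z, |z| ≤ R - s → w s z = v s z + r s z) :
    coneNorm H R w s ≤ 2 * coneNorm H R v s + 2 * coneNorm H R r s := by
  have h1 : supSq R w s ≤ 2 * supSq R v s + 2 * supSq R r s := by
    refine supSq_le hs.2.le fun z hz => ?_
    rw [h z hz]
    exact (ofReal_sq_add_le _ _).trans (add_le_add (mul_le_mul_right (le_supSq v hs.2 hz) _)
      (mul_le_mul_right (le_supSq r hs.2 hz) _))
  have h2 : enSq H (R - s) (w s) ≤ 2 * enSq H (R - s) (fun z => w s z - r s z) +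
      2 * enSq H (R - s) (r s) + 0 * idEnergy H R := by
    refine enSq_le_of_increments (by linarith [hs.1]) (hs.1.trans hs.2.le) (hw.sub hr) hr ?_
    intro z h _ _
    have e : w s (z + h) - w s z = (w s (z + h) - r s (z + h) - (w s z - r s z)) +
      (r s (z + h) - r s z) := by ring
    rw [zero_mul, add_zero, e]
    exact ofReal_sq_add_le _ _
  rw [zero_mul, add_zero] at h2
  have h3 : enSq H (R - s) (fun z => w s z - r s z) ≤ enSq H (R - s) (v s) :=
    enSq_mono_of_eqOn fun z hz => by rw [h z hz, add_sub_cancel_right]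
  refine (add_le_add h1 (h2.trans (add_le_add_left (mul_le_mul_right h3 _) _))).trans_eq ?_
  unfold coneNorm
  ring

lemma duhamel_sub_duhamel {H R T : ℝ} (hH : H ∈ Set.Ioo (1 / 4 : ℝ) (1 / 2 : ℝ)) (hR : T < R)
    {D₁ D₂ : ℝ → ℝ → ℝ} (hD₁ : Continuous fun q : ℝ × ℝ => D₁ q.1 q.2)
    (hD₂ : Continuous fun q : ℝ × ℝ => D₂ q.1 q.2)
    (hDT₁ : ∫⁻ s in Set.Icc (0 : ℝ) T, coneNorm H R D₁ s < ⊤)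
    (hDT₂ : ∫⁻ s in Set.Icc (0 : ℝ) T, coneNorm H R D₂ s < ⊤) {k₁ k₂ : ℝ → ℝ → ℝ}
    (hk₁ : Measurable fun q : ℝ × ℝ => k₁ q.1 q.2) (hk₂ : Measurable fun q : ℝ × ℝ => k₂ q.1 q.2)
    (hkT₁ : pathNormSq H T k₁ < ⊤) (hkT₂ : pathNormSq H T k₂ < ⊤) {p : ℝ × ℝ}
    (hp : p ∈ cone R T) :
    duhamel H T D₁ k₁ p - duhamel H T D₂ k₂ p =
      duhamel H T (fun s z => D₁ s z - D₂ s z) k₁ p +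
        duhamel H T D₂ (fun s z => k₁ s z - k₂ s z) p := by
  have m₁ := memLp_wIncr hH (measurable_mild hD₁.measurable p.1 p.2)
    (pathNormSq_mild_lt_top hH hR hD₁ hDT₁ hp)
  have m₂ := memLp_wIncr hH (measurable_mild hD₂.measurable p.1 p.2)
    (pathNormSq_mild_lt_top hH hR hD₂ hDT₂ hp)
  have n₁ := memLp_wIncr hH hk₁ hkT₁
  have n₂ := memLp_wIncr hH hk₂ hkT₂
  have e : mild (fun s z => D₁ s z - D₂ s z) p.1 p.2 =
      fun s z => mild D₁ p.1 p.2 s z - mild D₂ p.1 p.2 s z := by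
    funext s z
    simp only [mild, mul_sub]
  unfold duhamel
  rw [e, pathInner_sub_left hH m₁ m₂ n₁, pathInner_sub_right hH m₂ n₁ n₂]
  ring

lemma tendsto_lintegral_coneNorm_duhamel {H R T : ℝ} (hH : H ∈ Set.Ioo (1 / 4 : ℝ) (1 / 2 : ℝ))
    (hR : T < R) {D : ℝ → ℝ → ℝ} (hD : Continuous fun q : ℝ × ℝ => D q.1 q.2)
    (hDT : ∫⁻ s in Set.Icc (0 : ℝ) T, coneNorm H R D s < ⊤) {k : ℕ → ℝ → ℝ → ℝ}
    (hk : ∀ n, Measurable fun q : ℝ × ℝ => k n q.1 q.2) {M : ENNReal} (hM : M ≠ ⊤)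
    (hkM : ∀ n, pathNormSq H T (k n) ≤ M)
    (hlim : ∀ p ∈ cone R T, Filter.Tendsto (fun n => duhamel H T D (k n) p) Filter.atTop (nhds 0))
    {r : ℕ → ℝ → ℝ → ℝ} (hr : ∀ n, Measurable fun q : ℝ × ℝ => r n q.1 q.2)
    (hrk : ∀ n, ∀ p ∈ cone R T, r n p.1 p.2 = duhamel H T D (k n) p) :
    Filter.Tendsto (fun n => ∫⁻ t in Set.Icc (0 : ℝ) T, coneNorm H R (r n) t)
      Filter.atTop (nhds 0) := by
  let S : ℕ → ENNReal := fun n => ⨆ p ∈ cone R T, ENNReal.ofReal (duhamel H T D (k n) p ^ 2)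
  have hS : Filter.Tendsto S Filter.atTop (nhds 0) := by
    rw [ENNReal.tendsto_nhds_zero]
    intro ε hε
    filter_upwards [eventually_duhamel_sq_le hH hR hD hDT hk hM hkM hlim hε] with n hn
    exact iSup₂_le hn
  have hsum := (ENNReal.Tendsto.mul_const hS (b := ENNReal.ofReal T)
    (Or.inr ENNReal.ofReal_ne_top)).add
    (tendsto_lintegral_enSq_duhamel hH hR hD hDT hk hM hkM hlim hr hrk)
  rw [zero_mul, add_zero] at hsum
  refine tendsto_of_tendsto_of_tendsto_of_le_of_le tendsto_const_nhds hsum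
    (fun _ => zero_le) fun n => ?_
  unfold coneNorm
  simp only
  rw [lintegral_add_right _ (measurable_enSq H R (hr n))]
  refine add_le_add_left ?_ _
  calc ∫⁻ t in Set.Icc (0 : ℝ) T, supSq R (r n) t ≤ ∫⁻ _ in Set.Icc (0 : ℝ) T, S n := by
        refine setLIntegral_mono' measurableSet_Icc fun t ht => ?_
        refine supSq_le (ht.2.trans hR.le) fun z hz => ?_
        rw [hrk n (t, z) ⟨ht, hz⟩]
        exact le_iSup₂ (f := fun p (_ : p ∈ cone R T) =>
          ENNReal.ofReal (duhamel H T D (k n) p ^ 2)) (t, z) ⟨ht, hz⟩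
    _ = S n * ENNReal.ofReal T := by
        rw [lintegral_const, Measure.restrict_apply_univ, Real.volume_Icc, sub_zero]

lemma measurable_indicator_duhamel {H R T : ℝ} (hH : H ∈ Set.Ioo (1 / 4 : ℝ) (1 / 2 : ℝ))
    (hR : T < R) {D : ℝ → ℝ → ℝ} (hD : Continuous fun q : ℝ × ℝ => D q.1 q.2)
    (hDT : ∫⁻ s in Set.Icc (0 : ℝ) T, coneNorm H R D s < ⊤) {k : ℝ → ℝ → ℝ}
    (hk : Measurable fun q : ℝ × ℝ => k q.1 q.2) (hkT : pathNormSq H T k < ⊤) :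
    Measurable ((cone R T).indicator (duhamel H T D k)) := by
  classical
  rw [← Set.piecewise_eq_indicator]
  exact (continuousOn_duhamel hH hR hD hDT hk hkT).measurable_piecewise continuousOn_const
    (isCompact_cone R T).measurableSet

/-- Local stability: the nonlinear difference is controlled by the remainder `r` alone. -/
lemma exists_lintegral_nonlin_sub_le {H R T C : ℝ} (hH : H ∈ Set.Ioo (1 / 4 : ℝ) (1 / 2 : ℝ))
    (hR : T < R) {f : ℝ → ℝ → ℝ → ℝ} (hf : ∀ s, IsRegularNonlin C (f s)) {b : ℝ → ℝ → ℝ}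
    (hb : Continuous fun q : ℝ × ℝ => b q.1 q.2)
    (hbT : ∫⁻ s in Set.Icc (0 : ℝ) T, coneNorm H R b s < ⊤) {E : ENNReal} (hE : E ≠ ⊤)
    (hbE : ∀ s ∈ Set.Icc (0 : ℝ) T, enSq H (R - s) (b s) ≤ E) {κ ρ : ENNReal} (hκ : κ ≠ ⊤)
    (hρ : ρ ≠ ⊤) :
    ∃ L : ENNReal, L ≠ ⊤ ∧ ∀ a r : ℝ → ℝ → ℝ, (Continuous fun q : ℝ × ℝ => a q.1 q.2) →
      ∫⁻ s in Set.Icc (0 : ℝ) T, coneNorm H R (fun s z => a s z - b s z) s < ⊤ →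
      (∀ t ∈ Set.Icc (0 : ℝ) T, coneNorm H R r t ≤ ρ) →
      (∀ t ∈ Set.Icc (0 : ℝ) T, coneNorm H R (fun s z => a s z - b s z) t ≤
        coneNorm H R r t * 2 + κ * ∫⁻ s in Set.Icc (0 : ℝ) t,
          coneNorm H R (fun s z => f s z (a s z) - f s z (b s z)) s) →
      ∫⁻ s in Set.Icc (0 : ℝ) T, coneNorm H R (fun s z => f s z (a s z) - f s z (b s z)) s ≤
        L * ∫⁻ s in Set.Icc (0 : ℝ) T, coneNorm H R r s := by
  have hI := idEnergy_ne_top hH R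
  set c₁ := ENNReal.ofReal (4 * C ^ 2) * (4 + 4 * idEnergy H R) with hc₁
  have hc₁t : c₁ ≠ ⊤ := by finiteness
  set B := ∫⁻ s in Set.Icc (0 : ℝ) T, coneNorm H R b s
  obtain ⟨L₁, hL₁, h₁⟩ := exists_lintegral_le_of_gronwall T (c := κ * c₁) (by finiteness)
  set P := ρ * 2 + κ * (c₁ * B) with hP
  have hPt : P ≠ ⊤ := by finiteness
  set M := P + κ * c₁ * (L₁ * (P * ENNReal.ofReal T)) with hM
  have hMt : M ≠ ⊤ := by finiteness
  set c₂ := ENNReal.ofReal (4 * C ^ 2) * (1 + M + 4 * E + idEnergy H R) with hc₂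
  have hc₂t : c₂ ≠ ⊤ := by finiteness
  obtain ⟨L₂, hL₂, h₂⟩ := exists_lintegral_le_of_gronwall T (c := κ * c₂) (by finiteness)
  refine ⟨c₂ * (L₂ * 2), by finiteness, fun a r ha hfin hr hstep => ?_⟩
  set w : ℝ → ℝ → ℝ := fun s z => a s z - b s z with hw
  set D : ℝ → ℝ → ℝ := fun s z => f s z (a s z) - f s z (b s z) with hD
  have hwm : Measurable (coneNorm H R w) := measurable_coneNorm H R (ha.sub hb)
  have hbm : Measurable (coneNorm H R b) := measurable_coneNorm H R hb
  have hco : ∀ s ∈ Set.Icc (0 : ℝ) T, s ∈ Set.Ico 0 R := fun s hs => ⟨hs.1, hs.2.trans_lt hR⟩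
  have hstep₁ : ∀ t ∈ Set.Icc (0 : ℝ) T, coneNorm H R w t ≤
      P + κ * c₁ * ∫⁻ s in Set.Icc (0 : ℝ) t, coneNorm H R w s := by
    intro t ht
    have hD₁ : ∫⁻ s in Set.Icc (0 : ℝ) t, coneNorm H R D s ≤
        c₁ * ((∫⁻ s in Set.Icc (0 : ℝ) t, coneNorm H R w s) + B) := by
      calc _ ≤ ∫⁻ s in Set.Icc (0 : ℝ) t, c₁ * (coneNorm H R w s + coneNorm H R b s) :=
            setLIntegral_mono' measurableSet_Icc fun s hs => coneNorm_nonlin_sub_le hf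
              (hco s ⟨hs.1, hs.2.trans ht.2⟩) ha.measurable hb.measurable
        _ ≤ _ := by
            rw [lintegral_const_mul' _ _ hc₁t, lintegral_add_left hwm]
            exact mul_le_mul_right (add_le_add_right (lintegral_coneNorm_mono ht b) _) _
    refine (hstep t ht).trans ((add_le_add (mul_le_mul_left (hr t ht) _)
      (mul_le_mul_right hD₁ _)).trans_eq ?_)
    rw [hP]
    ring
  have hbound : ∀ t ∈ Set.Icc (0 : ℝ) T, coneNorm H R w t ≤ M := by
    intro t ht
    refine (hstep₁ t ht).trans (add_le_add_right (mul_le_mul_right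
      ((lintegral_coneNorm_mono ht w).trans ?_) _) _)
    have := h₁ _ (fun _ => P) hwm hfin hstep₁
    rwa [lintegral_const, Measure.restrict_apply_univ, Real.volume_Icc, sub_zero] at this
  have hD₂ : ∀ t ∈ Set.Icc (0 : ℝ) T, ∫⁻ s in Set.Icc (0 : ℝ) t, coneNorm H R D s ≤
      c₂ * ∫⁻ s in Set.Icc (0 : ℝ) t, coneNorm H R w s := by
    intro t ht
    rw [← lintegral_const_mul' _ _ hc₂t]
    refine setLIntegral_mono' measurableSet_Icc fun s hs => ?_
    have hsT : s ∈ Set.Icc (0 : ℝ) T := ⟨hs.1, hs.2.trans ht.2⟩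
    exact coneNorm_nonlin_sub_le_mul hf (hco s hsT) ha.measurable hb.measurable
      (le_self_add.trans (hbound s hsT)) (hbE s hsT)
  rcases lt_or_ge T 0 with hT | hT
  · simp [Set.Icc_eq_empty hT.not_ge]
  have h₃ := h₂ _ (fun t => coneNorm H R r t * 2) hwm hfin fun t ht =>
    (hstep t ht).trans (add_le_add_right
      ((mul_le_mul_right (hD₂ t ht) _).trans_eq (mul_assoc _ _ _).symm) _)
  rw [lintegral_mul_const' _ _ (by simp)] at h₃
  refine (hD₂ T ⟨hT, le_rfl⟩).trans ((mul_le_mul_right h₃ _).trans_eq ?_)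
  ring

lemma lintegral_coneNorm_nonlin_lt_top {H R T C : ℝ} (hH : H ∈ Set.Ioo (1 / 4 : ℝ) (1 / 2 : ℝ))
    (hR : T < R) {f : ℝ → ℝ → ℝ → ℝ} (hf : ∀ s, IsRegularNonlin C (f s)) {a : ℝ → ℝ → ℝ}
    (ha : Continuous fun q : ℝ × ℝ => a q.1 q.2)
    (haT : ∫⁻ s in Set.Icc (0 : ℝ) T, coneNorm H R a s < ⊤) :
    ∫⁻ s in Set.Icc (0 : ℝ) T, coneNorm H R (fun s z => f s z (a s z)) s < ⊤ := by
  have hI := idEnergy_ne_top hH R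
  have h0 : ∀ s ∈ Set.Ico 0 R, coneNorm H R (fun _ _ => (0 : ℝ)) s = 0 := fun s hs => by
    simp [coneNorm, supSq, enSq]
  refine (setLIntegral_mono' measurableSet_Icc fun s hs =>
    (show _ ≤ ENNReal.ofReal (4 * C ^ 2) * (4 + 4 * idEnergy H R) *
      coneNorm H R a s from ?_)).trans_lt
    (b := ∫⁻ s in Set.Icc (0 : ℝ) T,
      ENNReal.ofReal (4 * C ^ 2) * (4 + 4 * idEnergy H R) * coneNorm H R a s) ?_
  · have hs' : s ∈ Set.Ico 0 R := ⟨hs.1, hs.2.trans_lt hR⟩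
    have := coneNorm_nonlin_sub_le (H := H) (b := fun _ _ => 0) hf hs' ha.measurable
      measurable_const
    simpa only [(hf _).zero, sub_zero, h0 s hs', add_zero] using this
  · rw [lintegral_const_mul' _ _ (by finiteness)]
    finiteness

lemma lintegral_coneNorm_sub_lt_top {H R T : ℝ} (hR : T < R) {a b : ℝ → ℝ → ℝ}
    (ha : Continuous fun q : ℝ × ℝ => a q.1 q.2) (hb : Continuous fun q : ℝ × ℝ => b q.1 q.2)
    (haT : ∫⁻ s in Set.Icc (0 : ℝ) T, coneNorm H R a s < ⊤)
    (hbT : ∫⁻ s in Set.Icc (0 : ℝ) T, coneNorm H R b s < ⊤) :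
    ∫⁻ s in Set.Icc (0 : ℝ) T, coneNorm H R (fun s z => a s z - b s z) s < ⊤ := by
  have hneg : ∀ s, coneNorm H R (fun s z => -b s z) s = coneNorm H R b s := by
    intro s
    simp only [coneNorm, supSq, enSq, neg_sq, ← neg_sub']
  refine (setLIntegral_mono' (g := fun s => 2 * coneNorm H R a s + 2 * coneNorm H R b s)
    measurableSet_Icc fun s hs => ?_).trans_lt ?_
  · rw [← hneg s]
    exact coneNorm_le_of_eq_add ⟨hs.1, hs.2.trans_lt hR⟩
      ((ha.sub hb).measurable.comp measurable_prodMk_left)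
      (hb.neg.measurable.comp measurable_prodMk_left) fun z _ => sub_eq_add_neg _ _
  · rw [lintegral_add_left ((measurable_coneNorm H R ha).const_mul 2),
      lintegral_const_mul' _ _ (by simp), lintegral_const_mul' _ _ (by simp)]
    finiteness

/-- Stability of mild solutions on a light cone under weak convergence of the controls. -/
lemma eventually_sub_sq_le_of_weak {H R T C : ℝ} (hH : H ∈ Set.Ioo (1 / 4 : ℝ) (1 / 2 : ℝ))
    (hR : T < R) {f : ℝ → ℝ → ℝ → ℝ} (hf : ∀ s, IsRegularNonlin C (f s))
    (hfc : Continuous fun p : ℝ × ℝ × ℝ => f p.1 p.2.1 p.2.2)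
    {a : ℕ → ℝ → ℝ → ℝ} {b : ℝ → ℝ → ℝ} (ha : ∀ n, Continuous fun q : ℝ × ℝ => a n q.1 q.2)
    (hb : Continuous fun q : ℝ × ℝ => b q.1 q.2)
    (haT : ∀ n, ∫⁻ s in Set.Icc (0 : ℝ) T, coneNorm H R (a n) s < ⊤)
    (hbT : ∫⁻ s in Set.Icc (0 : ℝ) T, coneNorm H R b s < ⊤) {E : ENNReal} (hE : E ≠ ⊤)
    (hbE : ∀ s ∈ Set.Icc (0 : ℝ) T, enSq H (R - s) (b s) ≤ E)
    {k : ℕ → ℝ → ℝ → ℝ} {g : ℝ → ℝ → ℝ} (hk : ∀ n, Measurable fun q : ℝ × ℝ => k n q.1 q.2)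
    (hg : Measurable fun q : ℝ × ℝ => g q.1 q.2) {M : ENNReal} (hM : M ≠ ⊤)
    (hkM : ∀ n, pathNormSq H T (k n) ≤ M) (hgM : pathNormSq H T g ≤ M)
    (hweak : ∀ h : ℝ → ℝ → ℝ, Measurable (fun q : ℝ × ℝ => h q.1 q.2) → pathNormSq H T h < ⊤ →
      Filter.Tendsto (fun n => pathInner H T (k n) h) Filter.atTop (nhds (pathInner H T g h)))
    (hsol : ∀ n, ∀ p ∈ cone R T, a n p.1 p.2 - b p.1 p.2 =
      duhamel H T (fun s z => f s z (a n s z)) (k n) p - duhamel H T (fun s z => f s z (b s z)) g p)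
    {ε : ENNReal} (hε : 0 < ε) :
    ∀ᶠ n in Filter.atTop, ∀ p ∈ cone R T,
      ENNReal.ofReal ((a n p.1 p.2 - b p.1 p.2) ^ 2) ≤ ε := by
  have hDc : ∀ {u : ℝ → ℝ → ℝ}, (Continuous fun q : ℝ × ℝ => u q.1 q.2) →
      Continuous fun q : ℝ × ℝ => f q.1 q.2 (u q.1 q.2) := fun {u} hu =>
    hfc.comp (f := fun q : ℝ × ℝ => (q.1, q.2, u q.1 q.2)) (by fun_prop)
  have hDbT := lintegral_coneNorm_nonlin_lt_top hH hR hf hb hbT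
  have hDaT := fun n => lintegral_coneNorm_nonlin_lt_top hH hR hf (ha n) (haT n)
  have hDT := fun n => lintegral_coneNorm_sub_lt_top hR (hDc (ha n)) (hDc hb) (hDaT n) hDbT
  set Db : ℝ → ℝ → ℝ := fun s z => f s z (b s z) with hDb
  set D : ℕ → ℝ → ℝ → ℝ := fun n s z => f s z (a n s z) - f s z (b s z) with hD
  let j : ℕ → ℝ → ℝ → ℝ := fun n s z => k n s z - g s z
  have hj : ∀ n, Measurable fun q : ℝ × ℝ => j n q.1 q.2 := fun n => (hk n).sub hg
  have hjM : ∀ n, pathNormSq H T (j n) ≤ 4 * M := fun n => by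
    refine (pathNormSq_sub_le hH (hk n) hg).trans ?_
    calc _ ≤ 2 * M + 2 * M := by gcongr; exact hkM n
      _ = 4 * M := by ring
  have hM4 : 4 * M ≠ ⊤ := by finiteness
  have hjT : ∀ n, pathNormSq H T (j n) < ⊤ := fun n => (hjM n).trans_lt hM4.lt_top
  have hkT : ∀ n, pathNormSq H T (k n) < ⊤ := fun n => (hkM n).trans_lt hM.lt_top
  have hgT : pathNormSq H T g < ⊤ := hgM.trans_lt hM.lt_top
  have hlim : ∀ p ∈ cone R T,
      Filter.Tendsto (fun n => duhamel H T Db (j n) p) Filter.atTop (nhds 0) := by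
    intro p hp
    have hm := measurable_mild (D := Db) (hDc hb).measurable p.1 p.2
    have hmT := pathNormSq_mild_lt_top hH hR (hDc hb) hDbT hp
    have h1 := (hweak _ hm hmT).sub_const (pathInner H T g (mild Db p.1 p.2))
    rw [sub_self] at h1
    refine h1.congr fun n => ?_
    rw [duhamel, pathInner_sub_right hH (memLp_wIncr hH hm hmT) (memLp_wIncr hH (hk n) (hkT n))
      (memLp_wIncr hH hg hgT), pathInner_comm H T (k n), pathInner_comm H T g]
  let r : ℕ → ℝ → ℝ → ℝ := fun n s z => (cone R T).indicator (duhamel H T Db (j n)) (s, z)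
  have hr : ∀ n, Measurable fun q : ℝ × ℝ => r n q.1 q.2 := fun n =>
    measurable_indicator_duhamel hH hR (hDc hb) hDbT (hj n) (hjT n)
  have hrk : ∀ n, ∀ p ∈ cone R T, r n p.1 p.2 = duhamel H T Db (j n) p := fun n p hp =>
    Set.indicator_of_mem hp _
  have hadd : ∀ n, ∀ p ∈ cone R T,
      a n p.1 p.2 - b p.1 p.2 = duhamel H T (D n) (k n) p + r n p.1 p.2 := fun n p hp => by
    rw [hsol n p hp, hrk n p hp]
    exact duhamel_sub_duhamel hH hR (hDc (ha n)) (hDc hb) (hDaT n) hDbT (hk n) hg (hkT n) hgT hp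
  obtain ⟨K, hK, hKD⟩ := exists_coneNorm_pathInner_le hH hR
  have hv : ∀ n, ∀ t ∈ Set.Icc (0 : ℝ) T,
      coneNorm H R (fun t x => duhamel H T (D n) (k n) (t, x)) t ≤
        K * M * ∫⁻ s in Set.Icc (0 : ℝ) t, coneNorm H R (D n) s := fun n =>
    hKD _ ((hDc (ha n)).sub (hDc hb)) (hDT n) _ (hk n) M hM (hkM n)
  set ρ := K * (4 * M) * ∫⁻ s in Set.Icc (0 : ℝ) T, coneNorm H R Db s with hρ
  have hρr : ∀ n, ∀ t ∈ Set.Icc (0 : ℝ) T, coneNorm H R (r n) t ≤ ρ := fun n t ht =>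
    (coneNorm_mono_of_eqOn (w := fun t x => duhamel H T Db (j n) (t, x)) (ht.2.trans_lt hR)
      fun z hz => hrk n (t, z) ⟨ht, hz⟩).trans
      ((hKD _ (hDc hb) hDbT _ (hj n) _ hM4 (hjM n) t ht).trans
        (mul_le_mul_right (lintegral_coneNorm_mono ht Db) _))
  obtain ⟨L, hL, hLD⟩ := exists_lintegral_nonlin_sub_le hH hR hf hb hbT hE hbE
    (κ := 2 * (K * M)) (ρ := ρ) (by finiteness) (by finiteness)
  have hD_le : ∀ n, ∫⁻ s in Set.Icc (0 : ℝ) T, coneNorm H R (D n) s ≤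
      L * ∫⁻ s in Set.Icc (0 : ℝ) T, coneNorm H R (r n) s := fun n => by
    refine hLD (a n) (r n) (ha n)
      (lintegral_coneNorm_sub_lt_top hR (ha n) hb (haT n) hbT) (hρr n) fun t ht => ?_
    refine (coneNorm_le_of_eq_add (v := fun t x => duhamel H T (D n) (k n) (t, x))
      ⟨ht.1, ht.2.trans_lt hR⟩ (((ha n).sub hb).measurable.comp measurable_prodMk_left)
      ((hr n).comp measurable_prodMk_left) fun z hz => hadd n (t, z) ⟨ht, hz⟩).trans ?_
    rw [add_comm, mul_comm, mul_assoc]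
    exact add_le_add_right (mul_le_mul_right (hv n t ht) _) _
  have hlim₂ : Filter.Tendsto (fun n => 2 * (K * M * (L * ∫⁻ s in Set.Icc (0 : ℝ) T,
      coneNorm H R (r n) s))) Filter.atTop (nhds 0) := by
    have h := tendsto_lintegral_coneNorm_duhamel hH hR (hDc hb) hDbT hj hM4 hjM hlim hr hrk
    simpa using ENNReal.Tendsto.const_mul (a := 2) (ENNReal.Tendsto.const_mul (a := K * M)
      (ENNReal.Tendsto.const_mul h (Or.inr hL)) (Or.inr (by finiteness))) (Or.inr (by simp))
  filter_upwards [ENNReal.tendsto_nhds_zero.1 hlim₂ (ε / 2) (ENNReal.half_pos hε.ne'),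
    eventually_duhamel_sq_le hH hR (hDc hb) hDbT hj hM4 hjM hlim (ε := ε / 2 / 2)
      (ENNReal.half_pos (ENNReal.half_pos hε.ne').ne')] with n h1 h2 p hp
  rw [hadd n p hp, hrk n p hp]
  refine (ofReal_sq_add_le _ _).trans ?_
  rw [← ENNReal.add_halves ε]
  refine add_le_add (le_trans (mul_le_mul_right ?_ _) h1) ?_
  · refine (le_supSq (fun t x => duhamel H T (D n) (k n) (t, x)) (hp.1.2.trans_lt hR) hp.2).trans
      (le_self_add.trans ((hv n p.1 hp.1).trans (mul_le_mul_right ?_ _)))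
    exact (lintegral_coneNorm_mono hp.1 _).trans (hD_le n)
  · exact (mul_le_mul_right (h2 p hp) 2).trans_eq
      (ENNReal.mul_div_cancel (by simp) (by simp))

lemma eLpNorm_two_sq_eq {α : Type*} [MeasurableSpace α] (μ : Measure α) (f : α → ℝ) :
    eLpNorm f 2 μ ^ 2 = ∫⁻ x, ENNReal.ofReal (f x ^ 2) ∂μ := by
  have h := eLpNorm_nnreal_pow_eq_lintegral (f := f) (μ := μ) (p := 2) (by norm_num)
  simp only [NNReal.coe_ofNat, ENNReal.coe_ofNat, ENNReal.rpow_ofNat] at h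
  rw [h]
  refine lintegral_congr fun x => ?_
  rw [Real.enorm_eq_ofReal_abs, ← ENNReal.ofReal_pow (abs_nonneg _), sq_abs]

lemma hnSq_le_Znorm_sq {H T : ℝ} (u : ℝ → ℝ → ℝ) {t : ℝ} (ht : t ∈ Set.Icc (0 : ℝ) T) :
    hnSq H (u t) ≤ Znorm H 2 T u ^ 2 := by
  have e : ∫⁻ h : ℝ, (eLpNorm (fun x => u t (x + h) - u t x) (ENNReal.ofReal 2) volume) ^ 2 *
      ENNReal.ofReal (|h| ^ (2 * H - 2)) = hnSq H (u t) := by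
    refine lintegral_congr fun h => ?_
    rw [ENNReal.ofReal_ofNat, eLpNorm_two_sq_eq, lintegral_mul_const' _ _ (by simp [wgt])]
    rfl
  have h1 : hnSq H (u t) ^ ((1 : ℝ) / 2) ≤ Znorm H 2 T u := by
    rw [← e]
    exact (le_iSup₂ (f := fun t (_ : t ∈ Set.Icc (0 : ℝ) T) => (∫⁻ h : ℝ,
      (eLpNorm (fun x => u t (x + h) - u t x) (ENNReal.ofReal 2) volume) ^ 2 *
        ENNReal.ofReal (|h| ^ (2 * H - 2))) ^ ((1 : ℝ) / 2)) t ht).trans le_add_self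
  refine le_trans (le_of_eq ?_) (pow_le_pow_left₀ zero_le h1 2)
  rw [← ENNReal.rpow_natCast, ← ENNReal.rpow_mul]
  norm_num

/-- Freezing a path outside the time interval `[0, T]`. -/
noncomputable def clampTime {β : Type*} (T : ℝ) (u : ℝ → β) (s : ℝ) : β := u (max 0 (min T s))

lemma clampTime_eq {β : Type*} {T s : ℝ} (u : ℝ → β) (hs : s ∈ Set.Icc (0 : ℝ) T) :
    clampTime T u s = u s := by
  rw [clampTime, min_eq_right hs.2, max_eq_right hs.1]

lemma max_min_mem_Icc {T : ℝ} (hT : 0 ≤ T) (s : ℝ) : max 0 (min T s) ∈ Set.Icc (0 : ℝ) T :=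
  ⟨le_max_left _ _, max_le hT (min_le_left _ _)⟩

lemma continuous_clampTime {T : ℝ} (hT : 0 ≤ T) {u : ℝ → ℝ → ℝ}
    (hu : ContinuousOn (fun q : ℝ × ℝ => u q.1 q.2) (Set.Icc (0 : ℝ) T ×ˢ (Set.univ : Set ℝ))) :
    Continuous fun q : ℝ × ℝ => clampTime T u q.1 q.2 :=
  hu.comp_continuous (f := fun q : ℝ × ℝ => (max 0 (min T q.1), q.2)) (by fun_prop)
    fun q => ⟨max_min_mem_Icc hT q.1, Set.mem_univ _⟩

lemma enSq_clampTime_le {H R T s : ℝ} (u : ℝ → ℝ → ℝ) (hs : s ∈ Set.Icc (0 : ℝ) T) :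
    enSq H (R - s) (clampTime T u s) ≤ Znorm H 2 T u ^ 2 := by
  rw [clampTime_eq u hs]
  exact (enSq_le_hnSq _ _ _).trans (hnSq_le_Znorm_sq u hs)

lemma lintegral_coneNorm_clampTime_lt_top {H R T : ℝ} (hT : 0 ≤ T) (hR : T < R)
    {u : ℝ → ℝ → ℝ}
    (hu : ContinuousOn (fun q : ℝ × ℝ => u q.1 q.2) (Set.Icc (0 : ℝ) T ×ˢ (Set.univ : Set ℝ)))
    (huZ : Znorm H 2 T u < ⊤) :
    ∫⁻ s in Set.Icc (0 : ℝ) T, coneNorm H R (clampTime T u) s < ⊤ := by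
  obtain ⟨B, hB⟩ := (isCompact_cone R T).exists_bound_of_continuousOn
    (continuous_clampTime hT hu).continuousOn
  refine (setLIntegral_mono' (g := fun _ => ENNReal.ofReal (B ^ 2) + Znorm H 2 T u ^ 2)
    measurableSet_Icc fun s hs => add_le_add (supSq_le (hs.2.trans hR.le) fun z hz => ?_)
    (enSq_clampTime_le u hs)).trans_lt ?_
  · refine ENNReal.ofReal_le_ofReal ?_
    rw [← sq_abs]
    exact pow_le_pow_left₀ (abs_nonneg _) (hB (s, z) ⟨hs, hz⟩) 2
  · rw [lintegral_const, Measure.restrict_apply_univ, Real.volume_Icc]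
    finiteness

lemma setIntegral_eq_duhamel {H T : ℝ} (σ : ℝ → ℝ → ℝ → ℝ) (u g : ℝ → ℝ → ℝ) {t : ℝ}
    (ht : t ∈ Set.Icc (0 : ℝ) T) (x : ℝ) :
    ∫ s in Set.Icc (0 : ℝ) t, Hinner H (fun z => G (t - s) (x - z) * σ s z (u s z)) (g s) =
      duhamel H T (fun s z => clampTime T σ s z (clampTime T u s z)) g (t, x) := by
  unfold duhamel pathInner
  rw [setIntegral_eq_of_subset_of_forall_sdiff_eq_zero measurableSet_Icc
    (Set.Icc_subset_Icc_right ht.2)]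
  · refine setIntegral_congr_fun measurableSet_Icc fun s hs => ?_
    have hsT : s ∈ Set.Icc (0 : ℝ) T := ⟨hs.1, hs.2.trans ht.2⟩
    have : mild (fun s z => clampTime T σ s z (clampTime T u s z)) t x s =
        fun z => G (t - s) (x - z) * σ s z (u s z) := by
      funext z
      rw [mild, clampTime_eq _ hsT, clampTime_eq _ hsT]
    simp only [this]
  · intro s hs
    have hst : t - s ≤ 0 := by
      by_contra hcon
      exact hs.2 ⟨hs.1.1, by linarith⟩
    have : mild (fun s z => clampTime T σ s z (clampTime T u s z)) t x s = 0 := by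
      funext z
      simp [mild, G_eq_zero (hst.trans (abs_nonneg (x - z)))]
    simp [Hinner, this]

lemma isRegularNonlin_clampTime {T C : ℝ} (hT : 0 ≤ T) {σ : ℝ → ℝ → ℝ → ℝ}
    (h : ∀ t ∈ Set.Icc (0 : ℝ) T, IsRegularNonlin C (σ t)) (s : ℝ) :
    IsRegularNonlin C (clampTime T σ s) :=
  h _ (max_min_mem_Icc hT s)

lemma tendstoUniformlyOn_of_ofReal_sq {ι α : Type*} {l : Filter ι} {F : ι → α → ℝ} {f : α → ℝ}
    {s : Set α} (h : ∀ ε : ENNReal, 0 < ε →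
      ∀ᶠ n in l, ∀ p ∈ s, ENNReal.ofReal ((F n p - f p) ^ 2) ≤ ε) :
    TendstoUniformlyOn F f l s := by
  rw [Metric.tendstoUniformlyOn_iff]
  intro δ hδ
  have h0 : 0 < ENNReal.ofReal ((δ / 2) ^ 2) := ENNReal.ofReal_pos.2 (by positivity)
  filter_upwards [h _ h0] with n hn p hp
  have h1 := (ENNReal.ofReal_le_ofReal_iff (by positivity)).1 (hn p hp)
  have h2 := abs_le_of_sq_le_sq h1 (by positivity)
  rw [dist_comm, Real.dist_eq]
  exact h2.trans_lt (by linarith)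

theorem stmt14 (H T N C α : ℝ) (hH : H ∈ Set.Ioo (1 / 4 : ℝ) (1 / 2 : ℝ))
    (hT : 0 < T) (hN : 0 < N) (hC : 0 < C) (hα : α ∈ Set.Ioc (0 : ℝ) 1)
    (σ : ℝ → ℝ → ℝ → ℝ)
    (hσcont : ContinuousOn (fun p : ℝ × ℝ × ℝ => σ p.1 p.2.1 p.2.2)
      (Set.Icc (0 : ℝ) T ×ˢ (Set.univ : Set (ℝ × ℝ))))
    (hσ0 : ∀ t ∈ Set.Icc (0 : ℝ) T, ∀ x : ℝ, σ t x 0 = 0)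
    (hdx : ∀ t ∈ Set.Icc (0 : ℝ) T, ∀ u : ℝ, Differentiable ℝ (fun x => σ t x u))
    (hdu : ∀ t ∈ Set.Icc (0 : ℝ) T, ∀ x : ℝ, Differentiable ℝ (σ t x))
    (hdxu : ∀ t ∈ Set.Icc (0 : ℝ) T, ∀ u : ℝ, Differentiable ℝ (fun x => deriv (σ t x) u))
    (hcx : ContinuousOn (fun p : ℝ × ℝ × ℝ => deriv (fun x => σ p.1 x p.2.2) p.2.1)
      (Set.Icc (0 : ℝ) T ×ˢ (Set.univ : Set (ℝ × ℝ))))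
    (hcu : ContinuousOn (fun p : ℝ × ℝ × ℝ => deriv (σ p.1 p.2.1) p.2.2)
      (Set.Icc (0 : ℝ) T ×ˢ (Set.univ : Set (ℝ × ℝ))))
    (hcxu : ContinuousOn (fun p : ℝ × ℝ × ℝ => deriv (fun x => deriv (σ p.1 x) p.2.2) p.2.1)
      (Set.Icc (0 : ℝ) T ×ˢ (Set.univ : Set (ℝ × ℝ))))
    (hbu : ∀ t ∈ Set.Icc (0 : ℝ) T, ∀ x u : ℝ, |deriv (σ t x) u| ≤ C)
    (hbxu : ∀ t ∈ Set.Icc (0 : ℝ) T, ∀ x u : ℝ,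
      |deriv (fun x' => deriv (σ t x') u) x| ≤ C)
    (hlip : ∀ t ∈ Set.Icc (0 : ℝ) T, ∀ x u₁ u₂ : ℝ,
      |deriv (σ t x) u₁ - deriv (σ t x) u₂| ≤ C * |u₁ - u₂|)
    (u₀ v₀ : ℝ → ℝ) (K₁ K₂ : ℝ)
    (hu₀ : ∀ x y : ℝ, |u₀ x - u₀ y| ≤ K₁ * |x - y| ^ α)
    (hv₀ : ∀ x y : ℝ, |v₀ x - v₀ y| ≤ K₂ * |x - y| ^ α)
    (hI0 : ∃ p : ℝ, 2 / (4 * H - 1) < p ∧ Znorm H p T (I0 u₀ v₀) < ⊤)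
    -- the controls gₙ and g, all lying in S^N
    (gn : ℕ → ℝ → ℝ → ℝ) (g : ℝ → ℝ → ℝ)
    (hgnm : ∀ n, Measurable (fun q : ℝ × ℝ => gn n q.1 q.2))
    (hgm : Measurable (fun q : ℝ × ℝ => g q.1 q.2))
    (hgnN : ∀ n, (∫⁻ s in Set.Icc (0 : ℝ) T, HnormSq H (gn n s)) ≤ ENNReal.ofReal N)
    (hgN : (∫⁻ s in Set.Icc (0 : ℝ) T, HnormSq H (g s)) ≤ ENNReal.ofReal N)
    -- weak convergence gₙ → g
    (hweak : ∀ h : ℝ → ℝ → ℝ, Measurable (fun q : ℝ × ℝ => h q.1 q.2) →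
      (∫⁻ s in Set.Icc (0 : ℝ) T, HnormSq H (h s)) < ⊤ →
      Filter.Tendsto (fun n => ∫ s in Set.Icc (0 : ℝ) T, Hinner H (gn n s) (h s))
        Filter.atTop (nhds (∫ s in Set.Icc (0 : ℝ) T, Hinner H (g s) (h s))))
    -- the solutions u^{gₙ} and u^g of the skeleton equation
    (un : ℕ → ℝ → ℝ → ℝ) (ug : ℝ → ℝ → ℝ)
    (hun : ∀ n, IsSkelSolution H T σ u₀ v₀ (gn n) (un n))
    (hunZ : ∀ n, ∀ q : ℝ, 2 ≤ q → Znorm H q T (un n) < ⊤)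
    (hug : IsSkelSolution H T σ u₀ v₀ g ug)
    (hugZ : ∀ q : ℝ, 2 ≤ q → Znorm H q T ug < ⊤) :
    ∀ K : Set (ℝ × ℝ), IsCompact K → K ⊆ Set.Icc (0 : ℝ) T ×ˢ (Set.univ : Set ℝ) →
      TendstoUniformlyOn (fun n (q : ℝ × ℝ) => un n q.1 q.2)
        (fun q : ℝ × ℝ => ug q.1 q.2) Filter.atTop K := by
  intro K hK hKT
  obtain ⟨L, hL⟩ := hK.isBounded.exists_norm_le
  have hR : T < max L 0 + T + 1 := by linarith [le_max_right L 0]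
  have hKcone : K ⊆ cone (max L 0 + T + 1) T := by
    intro p hp
    have h1 := (hKT hp).1
    refine ⟨h1, ?_⟩
    have h2 := (norm_snd_le p).trans (hL p hp)
    rw [Real.norm_eq_abs] at h2
    linarith [le_max_left L 0, h1.2]
  have hreg : ∀ t ∈ Set.Icc (0 : ℝ) T, IsRegularNonlin C (σ t) := fun t ht =>
    ⟨hσ0 t ht, hdu t ht, hdxu t ht, hbu t ht, hbxu t ht, hlip t ht⟩
  have hfc : Continuous fun p : ℝ × ℝ × ℝ => clampTime T σ p.1 p.2.1 p.2.2 :=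
    hσcont.comp_continuous (f := fun p : ℝ × ℝ × ℝ => (max 0 (min T p.1), p.2)) (by fun_prop)
      fun q => ⟨max_min_mem_Icc hT.le q.1, Set.mem_univ _⟩
  refine tendstoUniformlyOn_of_ofReal_sq fun ε hε => ?_
  have hsol : ∀ n, ∀ p ∈ cone (max L 0 + T + 1) T,
      clampTime T (un n) p.1 p.2 - clampTime T ug p.1 p.2 =
        duhamel H T (fun s z => clampTime T σ s z (clampTime T (un n) s z)) (gn n) p -
          duhamel H T (fun s z => clampTime T σ s z (clampTime T ug s z)) g p := by
    intro n p hp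
    rw [clampTime_eq _ hp.1, clampTime_eq _ hp.1, ((hun n).2 p.1 hp.1 p.2).2.2,
      (hug.2 p.1 hp.1 p.2).2.2, setIntegral_eq_duhamel σ _ _ hp.1,
      setIntegral_eq_duhamel σ _ _ hp.1, add_sub_add_left_eq_sub]
  filter_upwards [eventually_sub_sq_le_of_weak hH hR
    (isRegularNonlin_clampTime hT.le hreg) hfc
    (fun n => continuous_clampTime hT.le (hun n).1) (continuous_clampTime hT.le hug.1)
    (fun n => lintegral_coneNorm_clampTime_lt_top hT.le hR (hun n).1 (hunZ n 2 le_rfl))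
    (lintegral_coneNorm_clampTime_lt_top hT.le hR hug.1 (hugZ 2 le_rfl))
    (ENNReal.pow_ne_top (hugZ 2 le_rfl).ne) (fun s hs => enSq_clampTime_le ug hs)
    hgnm hgm ENNReal.ofReal_ne_top hgnN hgN hweak hsol hε] with n hn p hp
  have h := hn p (hKcone hp)
  rwa [clampTime_eq _ (hKT hp).1, clampTime_eq _ (hKT hp).1] at h
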